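/- arXiv:0907.0662 — 7 statements merged into one kernel-verified Lean document; each statement's English description precedes it below -/
import Mathlib

section
/- Let N ≥ 2 be an integer, η = 2π/N, and let b(θ), c(θ) be complex numbers (the amplitudes b(iπ−θ), c(iπ−θ) evaluated at a point where they are defined). Index rank-1 particles by α ∈ {1,…,N} and rank-(N−1) particles (bound states of N−1 rank-1 particles) by strictly increasing (N−1)-tuples (ρ) = (ρ₁ < ⋯ < ρ_{N−1}) in {1,…,N}. Define the charge conjugation tensors C_{(ρ)α} = ε_{ρ₁⋯ρ_{N−1}α} and C^{α(σ)} = (−1)^{N−1} ε^{α σ₁⋯σ_{N−1}}, where ε is the totally antisymmetric symbol with ε_{1⋯N} = ε^{1⋯N} = 1, and also C^{(σ)δ} = (−1)^{N−1} ε^{σ₁⋯σ_{N−1} δ}. Define the rank-1 S-matrix S_{αβ}^{δγ} = δ_α^γ δ_β^δ · b + δ_α^δ δ_β^γ · c and the bound-state–particle S-matrix S_{(ρ)α}^{β(σ)} = (−1)^{N−1}( δ_{(ρ)}^{(σ)} δ_α^β · b + C^{β(σ)} C_{(ρ)α} · c ). Then the crossing relation holds: for all indices (ρ), β, δ, (σ),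 one has S_{(ρ)β}^{δ(σ)} = (−1)^{N−1} Σ_{γ,α} C_{(ρ)γ} · S_{βα}^{γδ} · C^{α(σ)}, where the sum runs over γ, α ∈ {1,…,N}. In particular Σ_α C_{(ρ)α} C^{α(σ)} = δ_{(ρ)}^{(σ)}. -/
open scoped BigOperators

noncomputable section

/-- The totally antisymmetric Levi-Civita symbol `ε` on tuples of indices,
normalized by `ε_{1⋯N} = 1`: the sign of the permutation if the tuple is a
bijection, and `0` otherwise. -/
def eps {N : ℕ} (f : Fin N → Fin N) : ℂ :=
  if h : Function.Bijective f then ((Equiv.Perm.sign (Equiv.ofBijective f h) : ℤ) : ℂ) else 0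

theorem eps_comp_perm {N : ℕ} (f : Fin N → Fin N) (e : Equiv.Perm (Fin N)) :
    eps (f ∘ e) = eps f * ((Equiv.Perm.sign e : ℤ) : ℂ) := by
  by_cases h : Function.Bijective f
  · have h' : Function.Bijective (f ∘ e) := h.comp e.bijective
    have key : Equiv.ofBijective (f ∘ e) h' = Equiv.ofBijective f h * e := by
      ext i
      rfl
    simp only [eps, dif_pos h, dif_pos h', key, Equiv.Perm.sign_mul, Units.val_mul, Int.cast_mul]
  · have h' : ¬ Function.Bijective (f ∘ e) := fun h' => h ((e.bijective.of_comp_iff f).1 h')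
    rw [eps, eps, dif_neg h, dif_neg h', zero_mul]

theorem eps_mul_self_of_bijective {N : ℕ} {f : Fin N → Fin N} (h : Function.Bijective f) :
    eps f * eps f = 1 := by
  rw [eps, dif_pos h]
  exact_mod_cast Int.units_coe_mul_self _

theorem eps_snoc_eq_eps_cons {n : ℕ} (σ : Fin n → Fin (n + 1)) (α : Fin (n + 1)) :
    eps (Fin.snoc σ α) = (-1 : ℂ) ^ n * eps (Fin.cons α σ) := by
  have h : (Fin.snoc σ α : Fin (n + 1) → Fin (n + 1)) =
      (Fin.cons α σ : Fin (n + 1) → Fin (n + 1)) ∘ finRotate (n + 1) :=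
    Fin.snoc_eq_cons_rotate σ α
  rw [h, eps_comp_perm, sign_finRotate]
  push_cast
  ring

theorem StrictMono.exists_eq_succAbove {n : ℕ} {ρ : Fin n → Fin (n + 1)} (hρ : StrictMono ρ) :
    ∃ a : Fin (n + 1), ρ = a.succAbove := by
  have hs : ¬ Function.Surjective ρ := fun hs => by
    simpa using Fintype.card_le_of_surjective ρ hs
  simp only [Function.Surjective, not_forall, not_exists] at hs
  obtain ⟨a, ha⟩ := hs
  refine ⟨a, (hρ.range_inj (Fin.strictMono_succAbove a)).1 ?_⟩
  rw [Fin.range_succAbove]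
  refine Set.eq_of_subset_of_ncard_le ?_ ?_
  · rintro _ ⟨i, rfl⟩
    exact ha i
  · rw [Set.ncard_compl, Set.ncard_singleton, Set.ncard_range_of_injective hρ.injective]
    simp

theorem bijective_snoc_succAbove_iff {n : ℕ} (a α : Fin (n + 1)) :
    Function.Bijective (Fin.snoc a.succAbove α : Fin (n + 1) → Fin (n + 1)) ↔ α = a := by
  rw [← Finite.injective_iff_bijective, Fin.snoc_injective_iff, Fin.range_succAbove]
  simp [Fin.succAbove_right_injective]

theorem sum_eps_snoc_mul_eps_cons {n : ℕ} {ρ σ : Fin n → Fin (n + 1)} (hρ : StrictMono ρ)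
    (hσ : StrictMono σ) :
    ∑ α : Fin (n + 1), eps (Fin.snoc ρ α) * ((-1 : ℂ) ^ n * eps (Fin.cons α σ)) =
      if ρ = σ then (1 : ℂ) else 0 := by
  obtain ⟨a, rfl⟩ := hρ.exists_eq_succAbove
  obtain ⟨a', rfl⟩ := hσ.exists_eq_succAbove
  have hzero (d α : Fin (n + 1)) (h : α ≠ d) : eps (Fin.snoc d.succAbove α) = 0 :=
    dif_neg (mt (bijective_snoc_succAbove_iff d α).1 h)
  simp only [← eps_snoc_eq_eps_cons, Fin.succAbove_left_injective.eq_iff]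
  rw [Finset.sum_eq_single a (fun α _ h => by rw [hzero a α h, zero_mul]) (by simp)]
  split_ifs with h
  · subst h
    exact eps_mul_self_of_bijective ((bijective_snoc_succAbove_iff a a).2 rfl)
  · rw [hzero a' a h, mul_zero]

/-- Crossing relation for the bound-state–particle S-matrix of the chiral
SU(N) Gross–Neveu model (here `N = n+1`, `n ≥ 1`): with
`C_{(ρ)α} = ε_{ρ₁⋯ρ_{N−1}α}`, `C^{α(σ)} = (−1)^{N−1} ε^{α σ₁⋯σ_{N−1}}`,
`S_{αβ}^{δγ} = δ_α^γ δ_β^δ b + δ_α^δ δ_β^γ c` and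
`S_{(ρ)α}^{β(σ)} = (−1)^{N−1}(δ_{(ρ)}^{(σ)} δ_α^β b + C^{β(σ)} C_{(ρ)α} c)`,
one has `S_{(ρ)β}^{δ(σ)} = (−1)^{N−1} Σ_{γ,α} C_{(ρ)γ} S_{βα}^{γδ} C^{α(σ)}`,
and in particular `Σ_α C_{(ρ)α} C^{α(σ)} = δ_{(ρ)}^{(σ)}`. -/
theorem suN_crossing (n : ℕ) (hn : 1 ≤ n) (b c : ℂ)
    (ρ σ : Fin n → Fin (n + 1)) (hρ : StrictMono ρ) (hσ : StrictMono σ)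
    (β δ : Fin (n + 1)) :
    ((-1 : ℂ)) ^ n *
        ((if ρ = σ then (1 : ℂ) else 0) * (if β = δ then (1 : ℂ) else 0) * b +
          ((-1 : ℂ)) ^ n * eps (Fin.cons δ σ) * eps (Fin.snoc ρ β) * c) =
      ((-1 : ℂ)) ^ n *
        ∑ γ : Fin (n + 1), ∑ α : Fin (n + 1),
          eps (Fin.snoc ρ γ) *
            ((if β = δ then (1 : ℂ) else 0) * (if α = γ then (1 : ℂ) else 0) * b +
              (if β = γ then (1 : ℂ) else 0) * (if α = δ then (1 : ℂ) else 0) * c) *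
            (((-1 : ℂ)) ^ n * eps (Fin.cons α σ)) ∧
    (∑ α : Fin (n + 1), eps (Fin.snoc ρ α) * (((-1 : ℂ)) ^ n * eps (Fin.cons α σ))) =
      (if ρ = σ then (1 : ℂ) else 0) := by
  have hsum := sum_eps_snoc_mul_eps_cons hρ hσ
  refine ⟨?_, hsum⟩
  rw [← hsum]
  congr 1
  simp only [mul_add, add_mul, Finset.sum_add_distrib]
  congr 1
  · rw [Finset.sum_mul, Finset.sum_mul]
    refine Finset.sum_congr rfl fun γ _ => ?_
    rw [Finset.sum_eq_single γ (fun α _ h => by simp [h]) (by simp), if_pos rfl]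
    ring
  · rw [Finset.sum_eq_single β (fun γ _ h => by simp [h.symm]) (by simp),
      Finset.sum_eq_single δ (fun α _ h => by simp [h]) (by simp), if_pos rfl, if_pos rfl]
    ring

end
end

section
/- Let N ≥ 2 be an integer, η = 2π/N, and a(θ) = −Γ(1 − θ/(2πi))·Γ(1 − 1/N + θ/(2πi)) / (Γ(1 + θ/(2πi))·Γ(1 − 1/N − θ/(2πi))). (a) For every real θ > 0 the improper integral A(θ) = lim_{T→∞} ∫₀^T (−2i)·e^{t/N}·sinh(t(1−1/N))·sin(tθ/π) / (t·sinh t) dt exists in ℂ and exp(A(θ)) = a(θ). (b) For every real θ, ∫₀^∞ e^{t/N}·sinh(t(1−1/N))·(1 − cos(tθ/π)) / (t·sinh² t) dt is absolutely convergent and unchanged under θ ↦ −θ. Parts (a) and (b) express that the minimal form factor F(θ) = exp I(θ), with I(θ) = ∫₀^∞ e^{t/N}·sinh(t(1−1/N))·(1 − cosh(t(1 − θ/(iπ)))) / (t·sinh² t) dt, satisfies Watson's equations F(θ) = F(−θ)·a(θ) and F(iπ−θ) = F(iπ+θ): A(θ) is the combined integrand of I(θ) − I(−θ), and the integral in (b)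 equals I(iπ∓θ). -/
open Complex MeasureTheory Filter

theorem integrableOn_exp_neg_mul_Ioi {a : ℝ} (ha : 0 < a) :
    IntegrableOn (fun t : ℝ => Real.exp (-(a * t))) (Set.Ioi 0) := by
  simpa only [neg_mul] using exp_neg_integrableOn_Ioi 0 ha

theorem abs_sin_mul_div_le (c t : ℝ) : |Real.sin (c * t) / t| ≤ |c| := by
  rcases eq_or_ne t 0 with rfl | ht
  · simp
  rw [abs_div, div_le_iff₀ (abs_pos.2 ht), ← abs_mul]
  exact Real.abs_sin_le_abs

theorem integrableOn_exp_neg_mul_sin_div {a : ℝ} (ha : 0 < a) (c : ℝ) :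
    IntegrableOn (fun t => Real.exp (-(a * t)) * (Real.sin (c * t) / t)) (Set.Ioi 0) := by
  refine ((integrableOn_exp_neg_mul_Ioi ha).mul_const |c|).mono'
    (by fun_prop : Measurable _).aestronglyMeasurable (ae_of_all _ fun t => ?_)
  rw [norm_mul, Real.norm_of_nonneg (Real.exp_pos _).le]
  exact mul_le_mul_of_nonneg_left (abs_sin_mul_div_le c t) (Real.exp_pos _).le

/-- The Laplace transform of the cosine. -/
theorem integral_exp_neg_mul_cos {a : ℝ} (ha : 0 < a) (c : ℝ) :
    ∫ t in Set.Ioi (0 : ℝ), Real.exp (-(a * t)) * Real.cos (c * t) = a / (a ^ 2 + c ^ 2) := by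
  have hre : ((-a + c * I : ℂ)).re < 0 := by simpa using ha
  have h := integral_exp_mul_complex_Ioi hre 0
  have hi := integrableOn_exp_mul_complex_Ioi hre 0
  have h2 := congrArg Complex.re h
  rw [← RCLike.re_to_complex, ← integral_re hi] at h2
  have e : ∀ t : ℝ, RCLike.re (Complex.exp ((-a + c * I) * t)) =
      Real.exp (-(a * t)) * Real.cos (c * t) := by
    intro t
    rw [RCLike.re_to_complex, Complex.exp_re]
    simp
  simp only [e] at h2
  rw [h2]
  simp [Complex.div_re, Complex.normSq_apply]
  have : a * a + c * c ≠ 0 := by nlinarith [mul_pos ha ha, mul_self_nonneg c]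
  field_simp

/-- The Laplace transform of the cardinal sine. -/
theorem integral_exp_neg_mul_sin_div {a : ℝ} (ha : 0 < a) (c : ℝ) :
    ∫ t in Set.Ioi (0 : ℝ), Real.exp (-(a * t)) * (Real.sin (c * t) / t) =
      Real.arctan (c / a) := by
  have hasDeriv_integral : ∀ x : ℝ, HasDerivAt
      (fun x : ℝ => ∫ t in Set.Ioi (0 : ℝ), Real.exp (-(a * t)) * (Real.sin (x * t) / t))
      (a / (a ^ 2 + x ^ 2)) x := by
    intro x
    rw [← integral_exp_neg_mul_cos ha x]
    refine (hasDerivAt_integral_of_dominated_loc_of_deriv_le (s := Set.univ)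
      (F' := fun x t => Real.exp (-(a * t)) * Real.cos (x * t))
      (bound := fun t => Real.exp (-(a * t))) Filter.univ_mem ?_ ?_ ?_ ?_
      (integrableOn_exp_neg_mul_Ioi ha) ?_).2
    · exact Eventually.of_forall fun y => (by fun_prop : Measurable _).aestronglyMeasurable
    · exact integrableOn_exp_neg_mul_sin_div ha x
    · exact (by fun_prop : Measurable _).aestronglyMeasurable
    · refine ae_of_all _ fun t y _ => ?_
      rw [norm_mul, Real.norm_of_nonneg (Real.exp_pos _).le]
      exact mul_le_of_le_one_right (Real.exp_pos _).le (Real.abs_cos_le_one _)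
    · refine (ae_restrict_mem measurableSet_Ioi).mono fun t ht y _ => ?_
      have ht' : t ≠ 0 := (Set.mem_Ioi.1 ht).ne'
      have := ((((hasDerivAt_id y).mul_const t).sin.div_const t).const_mul (Real.exp (-(a * t))))
      refine this.congr_deriv ?_
      simp only [id]
      field_simp
  have hasDeriv_arctan : ∀ x : ℝ, HasDerivAt
      (fun x : ℝ => Real.arctan (x / a)) (a / (a ^ 2 + x ^ 2)) x := by
    intro x
    refine ((hasDerivAt_id x).div_const a).arctan.congr_deriv ?_
    have : a ^ 2 + x ^ 2 ≠ 0 := by positivity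
    simp only [id]
    field_simp
  have hd : ∀ x : ℝ, HasDerivAt (fun x : ℝ => (∫ t in Set.Ioi (0 : ℝ),
      Real.exp (-(a * t)) * (Real.sin (x * t) / t)) - Real.arctan (x / a)) 0 x := fun x => by
    simpa using! (hasDeriv_integral x).sub (hasDeriv_arctan x)
  have := is_const_of_deriv_eq_zero (fun x => (hd x).differentiableAt) (fun x => (hd x).deriv) c 0
  simpa [sub_eq_zero] using this

theorem abs_dirichlet_remainder_le {u T : ℝ} (hu : 0 < u) (hT : 0 < T) :
    ‖Real.exp (-(u * T)) * (Real.cos T + u * Real.sin T) / (1 + u ^ 2)‖ ≤ 2 * (1 + u ^ 2)⁻¹ := by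
  have h0 : 0 < u * T := mul_pos hu hT
  have h1 : Real.exp (-(u * T)) * (1 + u * T) ≤ 1 := by
    rw [Real.exp_neg, inv_mul_le_iff₀ (Real.exp_pos _)]
    linarith [Real.add_one_le_exp (u * T)]
  have h2 : |Real.cos T + u * Real.sin T| ≤ 1 + u * T := by
    refine (abs_add_le _ _).trans (add_le_add (Real.abs_cos_le_one _) ?_)
    rw [abs_mul, abs_of_pos hu]
    have := Real.abs_sin_le_abs (x := T)
    rw [abs_of_pos hT] at this
    gcongr
  have h3 : (0 : ℝ) < 1 + u ^ 2 := by positivity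
  rw [norm_div, norm_mul, Real.norm_of_nonneg (Real.exp_pos _).le, Real.norm_of_nonneg h3.le,
    div_eq_mul_inv]
  refine mul_le_mul_of_nonneg_right ?_ (by positivity)
  have : Real.exp (-(u * T)) * ‖Real.cos T + u * Real.sin T‖ ≤
    Real.exp (-(u * T)) * (1 + u * T) := by gcongr; exact h2
  linarith

/-- The Dirichlet integral. -/
theorem tendsto_integral_sinc_atTop :
    Tendsto (fun T : ℝ => ∫ t in (0 : ℝ)..T, Real.sinc t) atTop (nhds (Real.pi / 2)) := by
  set f : ℝ → ℝ → ℝ := fun T u =>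
    Real.exp (-(u * T)) * (Real.cos T + u * Real.sin T) / (1 + u ^ 2) with hf
  set E : ℝ → ℝ := fun T => ∫ u in Set.Ioi (0 : ℝ), f T u
  have hbi : IntegrableOn (fun u : ℝ => 2 * (1 + u ^ 2)⁻¹) (Set.Ioi 0) :=
    (integrable_inv_one_add_sq.const_mul 2).integrableOn
  have hmeas : ∀ T, AEStronglyMeasurable (f T) (volume.restrict (Set.Ioi 0)) := fun T =>
    (by fun_prop : Measurable (f T)).aestronglyMeasurable
  have hbd : ∀ T, 0 < T → ∀ᵐ u ∂(volume.restrict (Set.Ioi (0 : ℝ))),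
      ‖f T u‖ ≤ 2 * (1 + u ^ 2)⁻¹ := fun T hT =>
    (ae_restrict_mem measurableSet_Ioi).mono fun u hu => abs_dirichlet_remainder_le hu hT
  have hEd : ∀ T, 0 < T → HasDerivAt E (-Real.sinc T) T := by
    intro T hT
    have hval : ∫ u in Set.Ioi (0 : ℝ), -(Real.exp (-(u * T)) * Real.sin T) = -Real.sinc T := by
      rw [integral_neg, integral_mul_const, Real.sinc_of_ne_zero hT.ne']
      have := integral_exp_mul_Ioi (neg_lt_zero.2 hT) 0
      simp only [mul_zero, Real.exp_zero, neg_div_neg_eq] at this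
      have e : ∀ u : ℝ, Real.exp (-(u * T)) = Real.exp (-T * u) := fun u => by ring_nf
      simp only [e, this]
      ring
    rw [← hval]
    refine (hasDerivAt_integral_of_dominated_loc_of_deriv_le (s := Set.Ioi (T / 2))
      (F' := fun T u => -(Real.exp (-(u * T)) * Real.sin T))
      (bound := fun u => Real.exp (-(T / 2 * u))) (Ioi_mem_nhds (by linarith)) ?_ ?_ ?_ ?_
      (integrableOn_exp_neg_mul_Ioi (by linarith)) ?_).2
    · exact Eventually.of_forall hmeas
    · exact hbi.mono' (hmeas T) (hbd T hT)
    · exact (by fun_prop : Measurable _).aestronglyMeasurable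
    · refine (ae_restrict_mem measurableSet_Ioi).mono fun u hu y hy => ?_
      rw [norm_neg, norm_mul, Real.norm_of_nonneg (Real.exp_pos _).le]
      refine (mul_le_of_le_one_right (Real.exp_pos _).le (Real.abs_sin_le_one _)).trans ?_
      simp only [Set.mem_Ioi] at hu hy
      rw [Real.exp_le_exp]
      nlinarith
    · refine ae_of_all _ fun u y _ => ?_
      have h := (((((hasDerivAt_id y).const_mul u).neg).exp.mul
        ((Real.hasDerivAt_cos y).add ((Real.hasDerivAt_sin y).const_mul u))).div_const (1 + u ^ 2))
      refine h.congr_deriv ?_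
      have : 1 + u ^ 2 ≠ 0 := by positivity
      simp only [id, Pi.neg_apply, Pi.add_apply]
      field_simp
      ring
  have hDd : ∀ T, HasDerivAt (fun T : ℝ => ∫ t in (0 : ℝ)..T, Real.sinc t) (Real.sinc T) T :=
    fun T => intervalIntegral.integral_hasDerivAt_right
      (Real.continuous_sinc.intervalIntegrable _ _)
      (Real.continuous_sinc.stronglyMeasurableAtFilter _ _) Real.continuous_sinc.continuousAt
  have hsum : ∀ T, 0 < T → HasDerivAt (fun T : ℝ => (∫ t in (0 : ℝ)..T, Real.sinc t) + E T) 0 T :=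
    fun T hT => by simpa using! (hDd T).add (hEd T hT)
  have hconst : ∀ T, 0 < T → (∫ t in (0 : ℝ)..T, Real.sinc t) + E T =
      (∫ t in (0 : ℝ)..1, Real.sinc t) + E 1 := fun T hT =>
    (convex_Ioi (0 : ℝ)).is_const_of_fderivWithin_eq_zero (𝕜 := ℝ)
      (fun y hy => (hsum y hy).differentiableAt.differentiableWithinAt)
      (fun y hy => by
        rw [fderivWithin_of_isOpen isOpen_Ioi hy]
        ext
        simpa using (hsum y hy).deriv) hT (Set.mem_Ioi.2 one_pos)
  have hE0 : Tendsto E (nhdsWithin 0 (Set.Ioi 0)) (nhds (Real.pi / 2)) := by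
    have hv : ∫ u in Set.Ioi (0 : ℝ), (1 + u ^ 2)⁻¹ = Real.pi / 2 := by
      rw [integral_Ioi_inv_one_add_sq, Real.arctan_zero, sub_zero]
    rw [← hv]
    refine tendsto_integral_filter_of_dominated_convergence _ (Eventually.of_forall hmeas)
      (eventually_mem_nhdsWithin.mono fun T hT => hbd T hT) hbi (ae_of_all _ fun u => ?_)
    have : Continuous fun T => f T u := by simp only [hf]; fun_prop
    have h := this.tendsto 0
    simp only [hf, mul_zero, neg_zero, Real.exp_zero, Real.cos_zero, Real.sin_zero, add_zero,
      one_mul, one_div] at h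
    exact h.mono_left nhdsWithin_le_nhds
  have hE1 : Tendsto E atTop (nhds 0) := by
    rw [← integral_zero ℝ ℝ (μ := volume.restrict (Set.Ioi (0 : ℝ)))]
    refine tendsto_integral_filter_of_dominated_convergence _ (Eventually.of_forall hmeas)
      ((eventually_gt_atTop 0).mono fun T hT => hbd T hT) hbi
      ((ae_restrict_mem measurableSet_Ioi).mono fun u hu => ?_)
    simp only [Set.mem_Ioi] at hu
    have h1 : Tendsto (fun T => Real.exp (-(u * T)) * ((1 + u) / (1 + u ^ 2))) atTop (nhds 0) := by
      have := (Real.tendsto_exp_neg_atTop_nhds_zero.comp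
        (tendsto_id.const_mul_atTop hu)).mul_const ((1 + u) / (1 + u ^ 2))
      simpa using this
    refine squeeze_zero_norm (fun T => ?_) h1
    simp only [hf]
    rw [mul_div_assoc, norm_mul, Real.norm_of_nonneg (Real.exp_pos _).le, norm_div,
      Real.norm_of_nonneg (by positivity : 0 ≤ 1 + u ^ 2)]
    gcongr
    refine (norm_add_le _ _).trans (add_le_add (Real.abs_cos_le_one _) ?_)
    rw [norm_mul, Real.norm_of_nonneg hu.le]
    exact mul_le_of_le_one_right hu.le (Real.abs_sin_le_one _)
  have hC : (∫ t in (0 : ℝ)..1, Real.sinc t) + E 1 = Real.pi / 2 := by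
    have h1 : Tendsto (fun T : ℝ => (∫ t in (0 : ℝ)..T, Real.sinc t) + E T)
        (nhdsWithin 0 (Set.Ioi 0)) (nhds (0 + Real.pi / 2)) := by
      refine Tendsto.add ?_ hE0
      have := (hDd 0).continuousAt.tendsto.mono_left (nhdsWithin_le_nhds (s := Set.Ioi 0))
      simpa using this
    rw [zero_add] at h1
    refine tendsto_nhds_unique (tendsto_const_nhds.congr' ?_) h1
    exact eventually_mem_nhdsWithin.mono fun T hT => (hconst T hT).symm
  have h := (tendsto_const_nhds (x := Real.pi / 2)).sub hE1
  rw [sub_zero] at h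
  refine h.congr' ((eventually_gt_atTop 0).mono fun T hT => ?_)
  have := hconst T hT
  linarith
theorem exp_two_mul_I_mul_arctan (y : ℝ) :
    Complex.exp (2 * I * (Real.arctan y : ℝ)) = (1 + y * I) / (1 - y * I) := by
  have h1 : (1 + y * I : ℂ) ≠ 0 := fun h => by simpa using congrArg Complex.re h
  have h2 : (1 - y * I : ℂ) ≠ 0 := fun h => by simpa using congrArg Complex.re h
  rw [Complex.ofReal_arctan, Complex.arctan]
  have : 2 * I * (-I / 2 * Complex.log ((1 + y * I) / (1 - y * I))) =
      Complex.log ((1 + y * I) / (1 - y * I)) := by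
    linear_combination (-Complex.log ((1 + y * I) / (1 - y * I))) * I_mul_I
  rw [this, Complex.exp_log (div_ne_zero h1 h2)]

theorem prod_GammaSeq_div {b : ℝ} (hb : 0 < b) (x : ℝ) {n : ℕ} (hn : n ≠ 0) :
    Complex.exp (2 * I * ((∑ k ∈ Finset.range (n + 1),
      (Real.arctan (x / (k + b)) - Real.arctan (x / (k + 1))) : ℝ) : ℂ)) =
    Complex.GammaSeq (1 + x * I) n * Complex.GammaSeq (b - x * I) n /
      (Complex.GammaSeq (1 - x * I) n * Complex.GammaSeq (b + x * I) n) := by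
  have hn' : (n : ℂ) ≠ 0 := Nat.cast_ne_zero.2 hn
  have hfac : (n.factorial : ℂ) ≠ 0 := Nat.cast_ne_zero.2 n.factorial_ne_zero
  have ne : ∀ (d y : ℝ), 0 < d → ∀ k : ℕ, (d + y * I + k : ℂ) ≠ 0 := fun d y hd k h => by
    have := congrArg Complex.re h
    simp at this
    linarith [k.cast_nonneg (α := ℝ)]
  have pne : ∀ (d y : ℝ), 0 < d → ∏ k ∈ Finset.range (n + 1), (d + y * I + k : ℂ) ≠ 0 :=
    fun d y hd => Finset.prod_ne_zero_iff.2 fun k _ => ne d y hd k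
  have e1 : ∀ (d : ℝ), 0 < d → ∀ k : ℕ,
      Complex.exp (2 * I * (Real.arctan (x / (k + d)) : ℝ)) =
        (d + x * I + k) / (d + (-x : ℝ) * I + k) := fun d hd k => by
    have hk : (k + d : ℂ) ≠ 0 := by exact_mod_cast (by positivity : (k + d : ℝ) ≠ 0)
    rw [exp_two_mul_I_mul_arctan]
    have h2 := ne d (-x) hd k
    have h3 : (1 - x / (k + d) * I : ℂ) ≠ 0 := fun h => h2 (by
      field_simp at h
      push_cast
      linear_combination h)
    push_cast at h2 ⊢
    rw [div_eq_div_iff h3 h2]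
    field_simp
    ring
  have cpow : (n : ℂ) ^ (1 + x * I) * (n : ℂ) ^ (b - x * I) =
      (n : ℂ) ^ (1 - x * I) * (n : ℂ) ^ (b + x * I) := by
    rw [← Complex.cpow_add _ _ hn', ← Complex.cpow_add _ _ hn']
    ring_nf
  have c1 : (n : ℂ) ^ (1 - x * I) ≠ 0 := by simp [Complex.cpow_eq_zero_iff, hn']
  have c2 : (n : ℂ) ^ (b + x * I) ≠ 0 := by simp [Complex.cpow_eq_zero_iff, hn']
  have p1 := pne 1 x one_pos
  have p2 := pne 1 (-x) one_pos
  have p3 := pne b x hb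
  have p4 := pne b (-x) hb
  rw [Complex.ofReal_sum, Finset.mul_sum, Complex.exp_sum]
  simp only [Complex.ofReal_sub, mul_sub, Complex.exp_sub]
  rw [Finset.prod_div_distrib]
  rw [Finset.prod_congr rfl fun k _ => e1 b hb k, Finset.prod_congr rfl fun k _ => e1 1 one_pos k]
  rw [Finset.prod_div_distrib, Finset.prod_div_distrib]
  simp only [Complex.GammaSeq]
  push_cast at p1 p2 p3 p4 ⊢
  simp only [neg_mul, ← sub_eq_add_neg] at p1 p2 p3 p4 ⊢
  field_simp
  linear_combination -cpow

theorem tendsto_exp_sum_arctan {b : ℝ} (hb : 0 < b) (x : ℝ) :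
    Tendsto (fun n : ℕ => Complex.exp (2 * I * ((∑ k ∈ Finset.range n,
      (Real.arctan (x / (k + b)) - Real.arctan (x / (k + 1))) : ℝ) : ℂ))) atTop
      (nhds (Complex.Gamma (1 + x * I) * Complex.Gamma (b - x * I) /
        (Complex.Gamma (1 - x * I) * Complex.Gamma (b + x * I)))) := by
  rw [← tendsto_add_atTop_iff_nat 1]
  have h1 : Complex.Gamma (1 - x * I) ≠ 0 := Complex.Gamma_ne_zero_of_re_pos (by simp)
  have h2 : Complex.Gamma (b + x * I) ≠ 0 := Complex.Gamma_ne_zero_of_re_pos (by simpa using hb)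
  refine Tendsto.congr' ?_ (((Complex.GammaSeq_tendsto_Gamma (1 + x * I)).mul
    (Complex.GammaSeq_tendsto_Gamma (b - x * I))).div
    ((Complex.GammaSeq_tendsto_Gamma (1 - x * I)).mul
    (Complex.GammaSeq_tendsto_Gamma (b + x * I))) (mul_ne_zero h1 h2))
  filter_upwards [eventually_ne_atTop 0] with n hn
  exact (prod_GammaSeq_div hb x hn).symm

/-- The ratio `(e^{-2bt} - e^{-2t}) / (1 - e^{-2t})` lies between `0` and `e^{-2bt}`. -/
theorem exp_ratio_bounds {b t : ℝ} (hb : 0 ≤ b) (hb1 : b ≤ 1) (ht : 0 < t) :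
    0 ≤ (Real.exp (-(2 * b * t)) - Real.exp (-(2 * t))) / (1 - Real.exp (-(2 * t))) ∧
    (Real.exp (-(2 * b * t)) - Real.exp (-(2 * t))) / (1 - Real.exp (-(2 * t))) ≤
      Real.exp (-(2 * b * t)) := by
  have h1 : Real.exp (-(2 * t)) < 1 := by rw [Real.exp_lt_one_iff]; linarith
  have h2 : Real.exp (-(2 * t)) ≤ Real.exp (-(2 * b * t)) := by
    rw [Real.exp_le_exp]; nlinarith
  have h3 : Real.exp (-(2 * b * t)) ≤ 1 := by
    rw [Real.exp_le_one_iff]; nlinarith [mul_nonneg hb ht.le]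
  refine ⟨div_nonneg (by linarith) (by linarith), ?_⟩
  rw [div_le_iff₀ (by linarith)]
  nlinarith [Real.exp_pos (-(2 * t))]

theorem integrableOn_exp_ratio_mul_sin_div {b : ℝ} (hb : 0 < b) (hb1 : b ≤ 1) (c : ℝ) :
    IntegrableOn (fun t => (Real.exp (-(2 * b * t)) - Real.exp (-(2 * t))) /
      (1 - Real.exp (-(2 * t))) * (Real.sin (c * t) / t)) (Set.Ioi 0) := by
  refine ((integrableOn_exp_neg_mul_Ioi (by positivity : 0 < 2 * b)).mul_const |c|).mono'
    (by fun_prop : Measurable _).aestronglyMeasurable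
    ((ae_restrict_mem measurableSet_Ioi).mono fun t ht => ?_)
  obtain ⟨h1, h2⟩ := exp_ratio_bounds hb.le hb1 ht
  rw [norm_mul, Real.norm_of_nonneg h1]
  exact mul_le_mul h2 (abs_sin_mul_div_le c t) (norm_nonneg _) (Real.exp_pos _).le

theorem sum_exp_neg_sub {b t : ℝ} (ht : 0 < t) (n : ℕ) :
    ∑ k ∈ Finset.range n, (Real.exp (-(2 * (k + b) * t)) - Real.exp (-(2 * (k + 1) * t))) =
    (Real.exp (-(2 * b * t)) - Real.exp (-(2 * t))) / (1 - Real.exp (-(2 * t))) *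
      (1 - Real.exp (-(2 * t)) ^ n) := by
  have h1 : Real.exp (-(2 * t)) < 1 := by rw [Real.exp_lt_one_iff]; linarith
  have e : ∀ k : ℕ, Real.exp (-(2 * (k + b) * t)) - Real.exp (-(2 * (k + 1) * t)) =
      (Real.exp (-(2 * b * t)) - Real.exp (-(2 * t))) * Real.exp (-(2 * t)) ^ k := fun k => by
    rw [← Real.exp_nat_mul, sub_mul, ← Real.exp_add, ← Real.exp_add]
    ring_nf
  simp only [e]
  rw [← Finset.mul_sum, geom_sum_eq h1.ne]
  have h2 : 1 - Real.exp (-(2 * t)) ≠ 0 := by linarith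
  have h3 : Real.exp (-(2 * t)) - 1 ≠ 0 := by linarith
  field_simp
  ring

theorem tendsto_sum_arctan {b : ℝ} (hb : 0 < b) (hb1 : b ≤ 1) (c : ℝ) :
    Tendsto (fun n : ℕ => ∑ k ∈ Finset.range n,
      (Real.arctan (c / 2 / (k + b)) - Real.arctan (c / 2 / (k + 1)))) atTop
      (nhds (∫ t in Set.Ioi (0 : ℝ), (Real.exp (-(2 * b * t)) - Real.exp (-(2 * t))) /
        (1 - Real.exp (-(2 * t))) * (Real.sin (c * t) / t))) := by
  have hterm : ∀ k : ℕ, ∀ d : ℝ, 0 < d → 0 < 2 * (k + d) := fun k d hd => by positivity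
  have hs : ∀ n : ℕ, ∑ k ∈ Finset.range n,
      (Real.arctan (c / 2 / (k + b)) - Real.arctan (c / 2 / (k + 1))) =
      ∫ t in Set.Ioi (0 : ℝ), (∑ k ∈ Finset.range n,
        (Real.exp (-(2 * (k + b) * t)) - Real.exp (-(2 * (k + 1) * t)))) *
        (Real.sin (c * t) / t) := fun n => by
    simp only [Finset.sum_mul, sub_mul]
    have hint : ∀ k ∈ Finset.range n, IntegrableOn (fun t =>
        Real.exp (-(2 * (k + b) * t)) * (Real.sin (c * t) / t) -
        Real.exp (-(2 * (k + 1) * t)) * (Real.sin (c * t) / t)) (Set.Ioi 0) := fun k _ =>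
      (integrableOn_exp_neg_mul_sin_div (hterm k b hb) c).sub
        (integrableOn_exp_neg_mul_sin_div (hterm k 1 one_pos) c)
    rw [integral_finsetSum _ hint]
    refine Finset.sum_congr rfl fun k _ => ?_
    rw [integral_sub (integrableOn_exp_neg_mul_sin_div (hterm k b hb) c)
      (integrableOn_exp_neg_mul_sin_div (hterm k 1 one_pos) c),
      integral_exp_neg_mul_sin_div (hterm k b hb), integral_exp_neg_mul_sin_div (hterm k 1 one_pos),
      div_div, div_div]
  simp only [hs]
  refine tendsto_integral_of_dominated_convergence
    (fun t => ‖(Real.exp (-(2 * b * t)) - Real.exp (-(2 * t))) /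
        (1 - Real.exp (-(2 * t))) * (Real.sin (c * t) / t)‖)
    (fun n => (by fun_prop : Measurable _).aestronglyMeasurable)
    (integrableOn_exp_ratio_mul_sin_div hb hb1 c).norm (fun n => ?_) ?_
  · refine (ae_restrict_mem measurableSet_Ioi).mono fun t ht => ?_
    have ht : 0 < t := ht
    have h1 : Real.exp (-(2 * t)) < 1 := by rw [Real.exp_lt_one_iff]; linarith
    have h2 : Real.exp (-(2 * t)) ^ n ≤ 1 := pow_le_one₀ (Real.exp_pos _).le h1.le
    have h3 : 0 < Real.exp (-(2 * t)) ^ n := by positivity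
    rw [sum_exp_neg_sub ht, mul_right_comm, norm_mul]
    refine mul_le_of_le_one_right (norm_nonneg _) ?_
    rw [Real.norm_of_nonneg (by linarith)]
    linarith
  · refine (ae_restrict_mem measurableSet_Ioi).mono fun t ht => ?_
    have ht : 0 < t := ht
    have h1 : Real.exp (-(2 * t)) < 1 := by rw [Real.exp_lt_one_iff]; linarith
    simp only [sum_exp_neg_sub ht]
    have := ((tendsto_pow_atTop_nhds_zero_of_lt_one (Real.exp_pos _).le h1).const_sub 1).const_mul
      ((Real.exp (-(2 * b * t)) - Real.exp (-(2 * t))) / (1 - Real.exp (-(2 * t))))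
    simpa using this.mul_const (Real.sin (c * t) / t)

theorem tendsto_integral_sin_mul_div {c : ℝ} (hc : 0 < c) :
    Tendsto (fun T : ℝ => ∫ t in (0 : ℝ)..T, Real.sin (c * t) / t) atTop
      (nhds (Real.pi / 2)) := by
  refine (tendsto_integral_sinc_atTop.comp (tendsto_id.const_mul_atTop hc)).congr'
    ((eventually_ge_atTop 0).mono fun T hT => ?_)
  have h := intervalIntegral.smul_integral_comp_mul_left (a := 0) (b := T) Real.sinc c
  rw [mul_zero] at h
  simp only [Function.comp_apply, id]
  rw [← h, ← intervalIntegral.integral_smul]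
  refine intervalIntegral.integral_congr_ae (ae_of_all _ fun t ht => ?_)
  rw [Set.uIoc_of_le hT] at ht
  rw [Real.sinc_of_ne_zero (mul_ne_zero hc.ne' ht.1.ne'), smul_eq_mul]
  field_simp

theorem sinh_eq_exp_div_two_mul (t : ℝ) :
    Real.sinh t = Real.exp t / 2 * (1 - Real.exp (-(2 * t))) := by
  rw [Real.sinh_eq, mul_sub, div_mul_eq_mul_div (Real.exp t) 2 (Real.exp _), ← Real.exp_add]
  ring_nf

theorem exp_mul_sinh_eq (ν t : ℝ) : Real.exp (t * ν) * Real.sinh (t * (1 - ν)) =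
    Real.exp t / 2 * (1 - Real.exp (-(2 * (1 - ν) * t))) := by
  rw [sinh_eq_exp_div_two_mul, ← mul_assoc, mul_div_assoc', ← Real.exp_add]
  ring_nf

/-- The integrand of the two-particle S-matrix phase, split into its Dirichlet part and an
absolutely integrable remainder. -/
theorem exp_mul_sinh_mul_sin_div {ν t : ℝ} (ht : 0 < t) (c : ℝ) :
    Real.exp (t * ν) * Real.sinh (t * (1 - ν)) * Real.sin (c * t) / (t * Real.sinh t) =
      Real.sin (c * t) / t - (Real.exp (-(2 * (1 - ν) * t)) - Real.exp (-(2 * t))) /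
        (1 - Real.exp (-(2 * t))) * (Real.sin (c * t) / t) := by
  have h1 : Real.exp (-(2 * t)) < 1 := by rw [Real.exp_lt_one_iff]; linarith
  have h2 : 1 - Real.exp (-(2 * t)) ≠ 0 := by linarith
  have h4 := Real.exp_pos t
  rw [exp_mul_sinh_eq, sinh_eq_exp_div_two_mul]
  field_simp
  ring

theorem exists_tendsto_integral_and_exp_eq {ν : ℝ} (hν : 0 ≤ ν) (hν1 : ν < 1) {x : ℝ}
    (hx : 0 < x) : ∃ A : ℂ,
    Tendsto (fun T : ℝ => ∫ t in (0 : ℝ)..T, (-2 * I) * ((Real.exp (t * ν) *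
      Real.sinh (t * (1 - ν)) * Real.sin (2 * x * t) / (t * Real.sinh t) : ℝ) : ℂ))
      atTop (nhds A) ∧
    Complex.exp A = -(Complex.Gamma (1 + x * I) * Complex.Gamma ((1 - ν : ℝ) - x * I)) /
      (Complex.Gamma (1 - x * I) * Complex.Gamma ((1 - ν : ℝ) + x * I)) := by
  have hb : 0 < 1 - ν := by linarith
  have hb1 : 1 - ν ≤ 1 := by linarith
  have hg := integrableOn_exp_ratio_mul_sin_div hb hb1 (2 * x)
  have hsum := tendsto_sum_arctan hb hb1 (2 * x)
  rw [mul_div_cancel_left₀ x two_ne_zero] at hsum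
  set g : ℝ → ℝ := fun t => (Real.exp (-(2 * (1 - ν) * t)) - Real.exp (-(2 * t))) /
    (1 - Real.exp (-(2 * t))) * (Real.sin (2 * x * t) / t)
  set J : ℝ := ∫ t in Set.Ioi (0 : ℝ), g t
  have hexpJ : Complex.exp (2 * I * (J : ℂ)) =
      Complex.Gamma (1 + x * I) * Complex.Gamma ((1 - ν : ℝ) - x * I) /
      (Complex.Gamma (1 - x * I) * Complex.Gamma ((1 - ν : ℝ) + x * I)) := by
    refine tendsto_nhds_unique ?_ (tendsto_exp_sum_arctan hb x)
    have hc : Continuous fun y : ℝ => Complex.exp (2 * I * (y : ℂ)) := by fun_prop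
    exact (hc.tendsto J).comp hsum
  refine ⟨-2 * I * ((Real.pi / 2 - J : ℝ) : ℂ), ?_, ?_⟩
  · have hD := (tendsto_integral_sin_mul_div (by positivity : 0 < 2 * x)).sub
      (intervalIntegral_tendsto_integral_Ioi 0 hg tendsto_id)
    have hD' := ((Complex.continuous_ofReal.tendsto _).comp hD).const_mul (-2 * I)
    refine hD'.congr' ((eventually_ge_atTop 0).mono fun T hT => ?_)
    have hi1 : IntervalIntegrable (fun t => Real.sin (2 * x * t) / t) volume 0 T :=
      intervalIntegrable_const.mono_fun' (by fun_prop : Measurable _).aestronglyMeasurable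
        (ae_of_all _ fun t => abs_sin_mul_div_le (2 * x) t)
    have hi2 : IntervalIntegrable g volume 0 T :=
      (intervalIntegrable_iff_integrableOn_Ioc_of_le hT).2 (hg.mono_set fun t ht => ht.1)
    beta_reduce
    rw [intervalIntegral.integral_const_mul, intervalIntegral.integral_ofReal, Function.comp_apply,
      id, ← intervalIntegral.integral_sub hi1 hi2]
    congr 2
    refine intervalIntegral.integral_congr_ae (ae_of_all _ fun t ht => ?_)
    rw [Set.uIoc_of_le hT] at ht
    exact (exp_mul_sinh_mul_sin_div ht.1 (2 * x)).symm
  · have : -2 * I * ((Real.pi / 2 - J : ℝ) : ℂ) = -(Real.pi * I) + 2 * I * (J : ℂ) := by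
      push_cast
      ring
    rw [this, Complex.exp_add, Complex.exp_neg, Complex.exp_pi_mul_I, hexpJ]
    ring

theorem exp_mul_sinh_le_sinh {ν t : ℝ} (hν : 0 ≤ ν) (ht : 0 ≤ t) :
    Real.exp (t * ν) * Real.sinh (t * (1 - ν)) ≤ Real.sinh t := by
  rw [exp_mul_sinh_eq, sinh_eq_exp_div_two_mul t]
  gcongr
  nlinarith [mul_nonneg hν ht]

theorem le_four_mul_exp_mul_sinh {t : ℝ} (ht : 0 ≤ t) :
    t ≤ 4 * Real.exp (-(1 / 2 * t)) * Real.sinh t := by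
  have h : Real.exp (-(1 / 2 * t)) * Real.sinh t =
      (Real.exp (t / 2) - Real.exp (-(3 / 2 * t))) / 2 := by
    rw [Real.sinh_eq, mul_div_assoc', mul_sub, ← Real.exp_add, ← Real.exp_add]
    ring_nf
  have h1 : Real.exp (-(3 / 2 * t)) ≤ 1 := Real.exp_le_one_iff.2 (by linarith)
  rw [mul_assoc, h]
  linarith [Real.add_one_le_exp (t / 2)]

theorem integrableOn_exp_mul_sinh_mul_one_sub_cos {ν : ℝ} (hν : 0 ≤ ν) (hν1 : ν ≤ 1) (c : ℝ) :
    IntegrableOn (fun t : ℝ => Real.exp (t * ν) * Real.sinh (t * (1 - ν)) *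
      (1 - Real.cos (c * t)) / (t * Real.sinh t ^ 2)) (Set.Ioi 0) := by
  refine ((integrableOn_exp_neg_mul_Ioi (by norm_num : (0 : ℝ) < 1 / 2)).const_mul
    (2 * c ^ 2)).mono' (by fun_prop : Measurable _).aestronglyMeasurable
    ((ae_restrict_mem measurableSet_Ioi).mono fun t ht => ?_)
  have ht : 0 < t := ht
  have hS : 0 < Real.sinh t := Real.sinh_pos_iff.2 ht
  have h1 := exp_mul_sinh_le_sinh hν ht.le
  have h2 : 1 - Real.cos (c * t) ≤ (c * t) ^ 2 / 2 := by
    linarith [Real.one_sub_sq_div_two_le_cos (x := c * t)]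
  have h3 := le_four_mul_exp_mul_sinh ht.le
  have h4 : 0 ≤ Real.sinh (t * (1 - ν)) :=
    Real.sinh_nonneg_iff.2 (mul_nonneg ht.le (by linarith))
  have h5 : 0 ≤ 1 - Real.cos (c * t) := by linarith [Real.cos_le_one (c * t)]
  rw [Real.norm_of_nonneg (by positivity), div_le_iff₀ (by positivity)]
  calc Real.exp (t * ν) * Real.sinh (t * (1 - ν)) * (1 - Real.cos (c * t))
      ≤ Real.sinh t * ((c * t) ^ 2 / 2) := by gcongr
    _ = c ^ 2 / 2 * t * Real.sinh t * t := by ring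
    _ ≤ c ^ 2 / 2 * t * Real.sinh t * (4 * Real.exp (-(1 / 2 * t)) * Real.sinh t) := by gcongr
    _ = _ := by ring

/-- Watson's equations for the minimal form factor `F(θ)` of two rank-1 particles
of the chiral SU(N) Gross–Neveu model, in integral form.
(a) For real `θ > 0`, the improper integral
`A(θ) = ∫₀^∞ (−2i)·e^{t/N}·sinh(t(1−1/N))·sin(tθ/π)/(t·sinh t) dt` exists and
`exp(A(θ)) = a(θ)`, expressing `F(θ) = F(−θ)·a(θ)`.
(b) For every real `θ`, the integral
`∫₀^∞ e^{t/N}·sinh(t(1−1/N))·(1 − cos(tθ/π))/(t·sinh²t) dt` is absolutely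
convergent and even in `θ`, expressing `F(iπ−θ) = F(iπ+θ)`. -/
theorem suN_minimal_form_factor_watson (N : ℕ) (hN : 2 ≤ N) :
    (∀ θ : ℝ, 0 < θ → ∃ A : ℂ,
      Tendsto (fun T : ℝ => ∫ t in (0 : ℝ)..T,
          (-2 * I) * ((Real.exp (t / N) * Real.sinh (t * (1 - 1 / N)) *
            Real.sin (t * θ / Real.pi) / (t * Real.sinh t) : ℝ) : ℂ))
        atTop (nhds A) ∧
      Complex.exp A =
        -(Complex.Gamma (1 - (θ : ℂ) / (2 * Real.pi * I)) *
            Complex.Gamma (1 - 1 / N + (θ : ℂ) / (2 * Real.pi * I))) /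
          (Complex.Gamma (1 + (θ : ℂ) / (2 * Real.pi * I)) *
            Complex.Gamma (1 - 1 / N - (θ : ℂ) / (2 * Real.pi * I)))) ∧
    (∀ θ : ℝ,
      IntegrableOn (fun t : ℝ =>
          Real.exp (t / N) * Real.sinh (t * (1 - 1 / N)) *
            (1 - Real.cos (t * θ / Real.pi)) / (t * Real.sinh t ^ 2))
        (Set.Ioi 0) ∧
      (∫ t in Set.Ioi (0 : ℝ),
          Real.exp (t / N) * Real.sinh (t * (1 - 1 / N)) *
            (1 - Real.cos (t * θ / Real.pi)) / (t * Real.sinh t ^ 2)) =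
        (∫ t in Set.Ioi (0 : ℝ),
          Real.exp (t / N) * Real.sinh (t * (1 - 1 / N)) *
            (1 - Real.cos (t * (-θ) / Real.pi)) / (t * Real.sinh t ^ 2))) := by
  have hν : (0 : ℝ) ≤ 1 / N := by positivity
  have hν1 : (1 : ℝ) / N < 1 := by
    rw [div_lt_one (by positivity)]
    exact_mod_cast hN
  refine ⟨fun θ hθ => ?_, fun θ => ⟨?_, ?_⟩⟩
  · obtain ⟨A, hA, hexp⟩ := exists_tendsto_integral_and_exp_eq hν hν1
      (by positivity : 0 < θ / (2 * Real.pi))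
    refine ⟨A, ?_, ?_⟩
    · have e : ∀ t : ℝ, 2 * (θ / (2 * Real.pi)) * t = t * θ / Real.pi := fun t => by
        field_simp
      simpa only [e, mul_one_div] using hA
    · have e : (θ : ℂ) / (2 * Real.pi * I) = -((θ / (2 * Real.pi) : ℝ) * I) := by
        push_cast
        rw [← div_div, Complex.div_I]
      have e1 : ((1 - 1 / N : ℝ) : ℂ) = 1 - 1 / N := by push_cast; rfl
      rw [hexp, e, e1]
      simp only [sub_neg_eq_add, ← sub_eq_add_neg]
  · have e : ∀ t : ℝ, θ / Real.pi * t = t * θ / Real.pi := fun t => by ring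
    simpa only [e, mul_one_div] using
      integrableOn_exp_mul_sinh_mul_one_sub_cos hν hν1.le (θ / Real.pi)
  · simp only [mul_neg, neg_div, Real.cos_neg]
end

section
/- Let N ≥ 2 be an integer. Define I(θ) = ∫₀^∞ e^{t/N}·sinh(t(1−1/N))·(1 − cosh(t(1 − θ/(iπ)))) / (t·sinh² t) dt (for real arguments −θ with θ > 0 understood as the improper limit lim_{T→∞} ∫₀^T), J(θ) = ∫₀^∞ e^{t/N}·sinh(t/N)·(1 − cosh(t(1 − θ/(iπ)))) / (t·sinh² t) dt, and φ̃(θ) = Γ(−θ/(2πi))·Γ(1 − 1/N + θ/(2πi)). Then the function θ ↦ exp(I(−θ) + J(iπ + θ))·φ̃(θ) is constant on the positive real axis: for all real θ₁, θ₂ > 0, exp(I(−θ₁) + J(iπ + θ₁))·φ̃(θ₁) = exp(I(−θ₂) + J(iπ + θ₂))·φ̃(θ₂). (With F = exp∘I and G = exp∘J this states that F(−θ)·G(iπ+θ)·φ̃(θ) is independent of θ, i.e. φ̃(θ) = const/(F(−θ)G(iπ+θ)).) -/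
open Complex MeasureTheory Filter

noncomputable section

/-- Integrand of the exponent `I(θ)` of the minimal form factor `F(θ) = exp I(θ)`
of two rank-1 particles of the chiral SU(N) Gross–Neveu model. -/
def Iintegrand (N : ℕ) (θ : ℂ) (t : ℝ) : ℂ :=
  Complex.exp (t / N) * Complex.sinh (t * (1 - 1 / N)) *
    (1 - Complex.cosh (t * (1 - θ / (I * Real.pi)))) / (t * Complex.sinh t ^ 2)

/-- Integrand of the exponent `J(θ)` of the minimal form factor `G(θ) = exp J(θ)`
of one rank-1 and one rank-(N−1) particle. -/
def Jintegrand (N : ℕ) (θ : ℂ) (t : ℝ) : ℂ :=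
  Complex.exp (t / N) * Complex.sinh (t / N) *
    (1 - Complex.cosh (t * (1 - θ / (I * Real.pi)))) / (t * Complex.sinh t ^ 2)

/-- The φ-function of the off-shell Bethe ansatz. -/
def phiTilde (N : ℕ) (θ : ℂ) : ℂ :=
  Complex.Gamma (-θ / (2 * Real.pi * I)) *
    Complex.Gamma (1 - 1 / N + θ / (2 * Real.pi * I))

theorem norm_exp_sub_one_le_mul_exp_norm (z : ℂ) :
    ‖Complex.exp z - 1‖ ≤ ‖z‖ * Real.exp ‖z‖ := by
  have h := (convex_closedBall (0 : ℂ) ‖z‖).norm_image_sub_le_of_norm_hasDerivWithin_le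
    (f := Complex.exp) (f' := Complex.exp) (C := Real.exp ‖z‖) (x := 0) (y := z)
    (fun x _ => (Complex.hasDerivAt_exp x).hasDerivWithinAt)
    (fun x hx => by
      rw [Complex.norm_exp]
      exact Real.exp_le_exp.2 ((Complex.re_le_norm x).trans (by simpa using hx)))
    (by simp) (by simp)
  simpa [mul_comm] using h

theorem norm_exp_neg_sub_exp_neg_le {z w : ℂ} (hz : 0 ≤ z.re) (hw : 0 ≤ w.re) :
    ‖Complex.exp (-z) - Complex.exp (-w)‖ ≤ ‖z - w‖ := by
  have h := (convex_halfSpace_re_ge 0).norm_image_sub_le_of_norm_hasDerivWithin_le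
    (f := fun u : ℂ => Complex.exp (-u)) (f' := fun u => Complex.exp (-u) * (-1)) (C := 1)
    (x := w) (y := z)
    (fun x _ => ((hasDerivAt_id x).neg.cexp).hasDerivWithinAt)
    (fun x hx => by
      have hx : 0 ≤ x.re := hx
      simpa [Complex.norm_exp] using hx)
    hw hz
  simpa using h

theorem norm_sinh_le_mul_exp_norm (z : ℂ) : ‖Complex.sinh z‖ ≤ ‖z‖ * Real.exp ‖z‖ := by
  have h : Complex.sinh z = ((Complex.exp z - 1) - (Complex.exp (-z) - 1)) / 2 := by
    rw [Complex.sinh]; ring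
  have h₁ := norm_exp_sub_one_le_mul_exp_norm z
  have h₂ := norm_exp_sub_one_le_mul_exp_norm (-z)
  have h₃ := norm_sub_le (Complex.exp z - 1) (Complex.exp (-z) - 1)
  rw [norm_neg] at h₂
  rw [h, norm_div, Complex.norm_ofNat]
  linarith

theorem norm_one_sub_cosh_le (z : ℂ) :
    ‖1 - Complex.cosh z‖ ≤ ‖z‖ ^ 2 * Real.exp ‖z‖ := by
  have h : 1 - Complex.cosh z = -(2 * Complex.sinh (z / 2) ^ 2) := by
    have h₁ := Complex.cosh_two_mul (z / 2)
    have h₂ := Complex.cosh_sq (z / 2)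
    rw [mul_div_cancel₀ z two_ne_zero] at h₁
    rw [h₁, h₂]; ring
  have h₁ := norm_sinh_le_mul_exp_norm (z / 2)
  rw [norm_div, Complex.norm_ofNat] at h₁
  have h₂ : Real.exp ‖z‖ = Real.exp (‖z‖ / 2) ^ 2 := by
    rw [← Real.exp_nat_mul]; congr 1; push_cast; ring
  rw [h, norm_neg, norm_mul, norm_pow, Complex.norm_ofNat, h₂]
  have h₃ := pow_le_pow_left₀ (norm_nonneg _) h₁ 2
  nlinarith [mul_nonneg (sq_nonneg ‖z‖) (sq_nonneg (Real.exp (‖z‖ / 2)))]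

theorem intervalIntegrable_of_norm_le {f : ℝ → ℂ} {T C : ℝ} (hT : 0 ≤ T) (hf : Measurable f)
    (hC : ∀ t ∈ Set.Ioc 0 T, ‖f t‖ ≤ C) : IntervalIntegrable f volume 0 T := by
  rw [intervalIntegrable_iff_integrableOn_Ioc_of_le hT]
  exact Measure.integrableOn_of_bounded (by simp) hf.aestronglyMeasurable
    ((ae_restrict_iff' measurableSet_Ioc).2 (ae_of_all _ hC))

theorem norm_exp_mul_sinh_mul_one_sub_cosh_div_le {a b c : ℂ} {t : ℝ} (ht : 0 < t) :
    ‖Complex.exp (t * a) * Complex.sinh (t * b) * (1 - Complex.cosh (t * c)) /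
      (t * Complex.sinh t ^ 2)‖ ≤ ‖b‖ * ‖c‖ ^ 2 * Real.exp (t * (‖a‖ + ‖b‖ + ‖c‖)) := by
  have h₁ : ‖Complex.exp (t * a)‖ ≤ Real.exp (t * ‖a‖) := by
    rw [Complex.norm_exp]
    refine Real.exp_le_exp.2 ((Complex.re_le_norm _).trans ?_)
    simp [abs_of_pos ht]
  have h₂ := norm_sinh_le_mul_exp_norm (t * b)
  have h₃ := norm_one_sub_cosh_le (t * c)
  have h₄ : t ≤ Real.sinh t := Real.self_le_sinh_iff.2 ht.le
  have h₅ : ‖Complex.sinh t‖ = Real.sinh t := by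
    rw [← Complex.ofReal_sinh, Complex.norm_real, Real.norm_of_nonneg (ht.le.trans h₄)]
  rw [norm_mul, Complex.norm_real, Real.norm_of_nonneg ht.le] at h₂ h₃
  rw [norm_div, norm_mul, norm_mul, norm_mul, norm_pow, h₅, Complex.norm_real,
    Real.norm_of_nonneg ht.le, div_le_iff₀ (by positivity)]
  calc _ ≤ Real.exp (t * ‖a‖) * (t * ‖b‖ * Real.exp (t * ‖b‖)) *
        ((t * ‖c‖) ^ 2 * Real.exp (t * ‖c‖)) := by gcongr
    _ = ‖b‖ * ‖c‖ ^ 2 * Real.exp (t * (‖a‖ + ‖b‖ + ‖c‖)) * (t * t ^ 2) := by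
      rw [mul_add, mul_add, Real.exp_add, Real.exp_add]; ring
    _ ≤ _ := by gcongr

theorem intervalIntegrable_exp_mul_sinh_mul_one_sub_cosh_div (a b c : ℂ) {T : ℝ} (hT : 0 ≤ T) :
    IntervalIntegrable (fun t : ℝ => Complex.exp (t * a) * Complex.sinh (t * b) *
      (1 - Complex.cosh (t * c)) / (t * Complex.sinh t ^ 2)) volume 0 T := by
  refine intervalIntegrable_of_norm_le hT
    (C := ‖b‖ * ‖c‖ ^ 2 * Real.exp (T * (‖a‖ + ‖b‖ + ‖c‖))) (by fun_prop) fun t ht => ?_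
  refine (norm_exp_mul_sinh_mul_one_sub_cosh_div_le ht.1).trans ?_
  have := ht.2
  gcongr

theorem intervalIntegrable_Iintegrand (N : ℕ) (θ : ℂ) {T : ℝ} (hT : 0 ≤ T) :
    IntervalIntegrable (Iintegrand N θ) volume 0 T := by
  convert intervalIntegrable_exp_mul_sinh_mul_one_sub_cosh_div (N : ℂ)⁻¹ (1 - 1 / N)
    (1 - θ / (I * Real.pi)) hT using 1
  ext t
  rw [Iintegrand, div_eq_mul_inv (t : ℂ)]

theorem intervalIntegrable_Jintegrand (N : ℕ) (θ : ℂ) {T : ℝ} (hT : 0 ≤ T) :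
    IntervalIntegrable (Jintegrand N θ) volume 0 T := by
  convert intervalIntegrable_exp_mul_sinh_mul_one_sub_cosh_div (N : ℂ)⁻¹ (N : ℂ)⁻¹
    (1 - θ / (I * Real.pi)) hT using 1
  ext t
  rw [Jintegrand, div_eq_mul_inv (t : ℂ)]

theorem le_one_add_mul_one_sub_exp_neg {s : ℝ} (hs : 0 ≤ s) :
    s ≤ (1 + s) * (1 - Real.exp (-s)) := by
  have h := Real.add_one_le_exp s
  have h₂ : Real.exp (-s) * Real.exp s = 1 := by rw [← Real.exp_add]; simp
  nlinarith [Real.exp_pos (-s)]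

theorem mul_exp_le_one_add_two_mul_sinh {t : ℝ} (ht : 0 ≤ t) :
    t * Real.exp t ≤ (1 + 2 * t) * Real.sinh t := by
  have h := le_one_add_mul_one_sub_exp_neg (s := 2 * t) (by positivity)
  have h₂ : Real.exp (-t) = Real.exp t * Real.exp (-(2 * t)) := by
    rw [← Real.exp_add]; congr 1; ring
  rw [Real.sinh_eq, h₂]
  nlinarith [Real.exp_pos t]

theorem integrableOn_Jintegrand (N : ℕ) (hN : 2 ≤ N) (θ : ℝ) :
    IntegrableOn (Jintegrand N (I * Real.pi + θ)) (Set.Ioi 0) := by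
  have hmeas : Measurable (Jintegrand N (I * Real.pi + θ)) := by
    unfold Jintegrand; fun_prop
  refine Integrable.mono' (((exp_neg_integrableOn_Ioi 0 (b := 1 / 2) (by norm_num)).const_mul
    (16 * (θ / Real.pi) ^ 2))) hmeas.aestronglyMeasurable
    ((ae_restrict_iff' measurableSet_Ioi).2 (ae_of_all _ fun t ht => ?_))
  have ht : 0 < t := ht
  have hN' : (0 : ℝ) < N := by positivity
  have htN : t / N ≤ t / 2 := by
    gcongr; exact_mod_cast hN
  have h₁ : ‖Complex.exp (t / N)‖ ≤ Real.exp (t / 2) := by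
    rw [Complex.norm_exp]
    refine Real.exp_le_exp.2 ?_
    have : ((t : ℂ) / N) = ((t / N : ℝ) : ℂ) := by push_cast; rfl
    rwa [this, Complex.ofReal_re]
  have h₂ : ‖Complex.sinh (t / N)‖ ≤ t / 2 * Real.exp (t / 2) := by
    have : ‖(t : ℂ) / N‖ ≤ t / 2 := by
      simpa [abs_of_pos ht] using htN
    refine (norm_sinh_le_mul_exp_norm _).trans ?_
    gcongr
  have h₃ : ‖1 - Complex.cosh (t * (1 - (I * Real.pi + θ) / (I * Real.pi)))‖ ≤
      (t * (θ / Real.pi)) ^ 2 / 2 := by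
    have hπ : (Real.pi : ℂ) ≠ 0 := by exact_mod_cast Real.pi_ne_zero
    have : (t : ℂ) * (1 - (I * Real.pi + θ) / (I * Real.pi)) =
        ((t * (θ / Real.pi) : ℝ) : ℂ) * I := by
      push_cast
      field_simp
      rw [I_sq]; ring
    rw [this, Complex.cosh_mul_I, ← Complex.ofReal_cos, ← Complex.ofReal_one,
      ← Complex.ofReal_sub, Complex.norm_real,
      Real.norm_of_nonneg (sub_nonneg.2 (Real.cos_le_one _))]
    linarith [Real.one_sub_sq_div_two_le_cos (x := t * (θ / Real.pi))]
  have h₄ := mul_exp_le_one_add_two_mul_sinh ht.le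
  have hs : 0 < Real.sinh t := Real.sinh_pos_iff.2 ht
  have h₅ : ‖Complex.sinh t‖ = Real.sinh t := by
    rw [← Complex.ofReal_sinh, Complex.norm_real, Real.norm_of_nonneg hs.le]
  have h₆ : 1 + 2 * t ≤ 8 * Real.exp (t / 4) := by
    linarith [Real.add_one_le_exp (t / 4)]
  have h₇ : t * Real.exp t ≤ 8 * Real.exp (t / 4) * Real.sinh t :=
    h₄.trans (by gcongr)
  rw [Jintegrand, norm_div, norm_mul, norm_mul, norm_mul, norm_pow, h₅, Complex.norm_real,
    Real.norm_of_nonneg ht.le, div_le_iff₀ (by positivity)]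
  calc _ ≤ Real.exp (t / 2) * (t / 2 * Real.exp (t / 2)) * ((t * (θ / Real.pi)) ^ 2 / 2) := by
        gcongr
    _ = (θ / Real.pi) ^ 2 * t / 4 * (Real.exp (-t) * (t * Real.exp t) ^ 2) := by
        have e₁ : Real.exp t = Real.exp (t / 2) ^ 2 := by
          rw [← Real.exp_nat_mul]; congr 1; push_cast; ring
        rw [Real.exp_neg, e₁]
        field_simp; ring
    _ ≤ (θ / Real.pi) ^ 2 * t / 4 *
          (Real.exp (-t) * (8 * Real.exp (t / 4) * Real.sinh t) ^ 2) := by gcongr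
    _ = _ := by
        have e₁ : Real.exp (-t) * Real.exp (t / 4) ^ 2 = Real.exp (-(1 / 2) * t) := by
          rw [← Real.exp_nat_mul, ← Real.exp_add]; congr 1; push_cast; ring
        rw [← e₁]; ring

theorem intervalIntegrable_exp_sub_exp_div {p q : ℂ} (hp : 0 ≤ p.re) (hq : 0 ≤ q.re) {T : ℝ}
    (hT : 0 ≤ T) : IntervalIntegrable
      (fun t : ℝ => (Complex.exp (-(t * q)) - Complex.exp (-(t * p))) / t) volume 0 T := by
  refine intervalIntegrable_of_norm_le hT (C := ‖q - p‖) (by fun_prop) fun t ht => ?_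
  have h := norm_exp_neg_sub_exp_neg_le (z := t * q) (w := t * p)
    (by simpa using mul_nonneg ht.1.le hq) (by simpa using mul_nonneg ht.1.le hp)
  rw [← mul_sub, norm_mul, Complex.norm_real, Real.norm_of_nonneg ht.1.le] at h
  rw [norm_div, Complex.norm_real, Real.norm_of_nonneg ht.1.le, div_le_iff₀ ht.1]
  linarith

theorem hasDerivAt_integral_exp_sub_exp_div {p z : ℂ} (hp : 0 ≤ p.re) (hz : 0 ≤ z.re)
    (hz0 : z ≠ 0) {T : ℝ} (hT : 0 ≤ T) :
    HasDerivAt (fun q : ℂ => ∫ t in (0 : ℝ)..T,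
      (Complex.exp (-(t * q)) - Complex.exp (-(t * p))) / t)
      ((Complex.exp (-(T * z)) - 1) / z) z := by
  have h := (intervalIntegral.hasDerivAt_integral_of_dominated_loc_of_deriv_le
    (μ := volume) (a := 0) (b := T)
    (F := fun (q : ℂ) (t : ℝ) => (Complex.exp (-(t * q)) - Complex.exp (-(t * p))) / t)
    (F' := fun (q : ℂ) (t : ℝ) => -Complex.exp (-(t * q)))
    (bound := fun _ => Real.exp (T * (‖z‖ + 1))) (Metric.ball_mem_nhds z one_pos)
    (Eventually.of_forall fun q => Measurable.aestronglyMeasurable (by fun_prop))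
    (intervalIntegrable_exp_sub_exp_div hp hz hT)
    (Measurable.aestronglyMeasurable (by fun_prop))
    (ae_of_all _ fun t ht x hx => ?_) (by simp)
    (ae_of_all _ fun t ht x hx => ?_)).2
  · refine h.congr_deriv ?_
    have e := integral_exp_mul_complex (a := 0) (b := T) (neg_ne_zero.2 hz0)
    rw [intervalIntegral.integral_neg]
    simp only [mul_comm _ z, ← neg_mul]
    rw [e]
    field_simp
    simp
  · rw [Set.uIoc_of_le hT] at ht
    have hx' : ‖x‖ ≤ ‖z‖ + 1 := by
      have := norm_sub_norm_le x z
      rw [Metric.mem_ball, dist_eq_norm] at hx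
      linarith
    rw [norm_neg, Complex.norm_exp]
    refine Real.exp_le_exp.2 ((Complex.re_le_norm _).trans ?_)
    rw [norm_neg, norm_mul, Complex.norm_real, Real.norm_of_nonneg ht.1.le]
    exact mul_le_mul ht.2 hx' (norm_nonneg _) hT
  · rw [Set.uIoc_of_le hT] at ht
    have ht0 : (t : ℂ) ≠ 0 := by exact_mod_cast ht.1.ne'
    have := (((((hasDerivAt_id x).const_mul (t : ℂ)).neg.cexp).sub_const
      (Complex.exp (-(t * p)))).div_const (t : ℂ))
    refine this.congr_deriv ?_
    simp only [id, mul_one, Pi.neg_apply]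
    field_simp

/-- Frullani's integral for complex exponentials, as an improper integral allowing exponents
on the boundary of the half plane of convergence. -/
theorem tendsto_integral_exp_sub_exp_div {S : Set ℂ} (hS : Convex ℝ S) {m : ℝ} (hm : 0 < m)
    (hSm : ∀ z ∈ S, m ≤ ‖z‖) (hre : ∀ z ∈ S, 0 ≤ z.re) {p q : ℂ} (hp : p ∈ S) (hq : q ∈ S) :
    Tendsto (fun T : ℝ => ∫ t in (0 : ℝ)..T,
      (Complex.exp (-(t * q)) - Complex.exp (-(t * p))) / t) atTop
      (nhds (Complex.log p - Complex.log q)) := by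
  rw [tendsto_iff_norm_sub_tendsto_zero]
  refine squeeze_zero' (g := fun T : ℝ => (‖q - p‖ / m ^ 2 + 2 / m) / T)
    (Eventually.of_forall fun _ => norm_nonneg _) ?_ (tendsto_const_nhds.div_atTop tendsto_id)
  filter_upwards [eventually_gt_atTop 0] with T hT
  have hne : ∀ z ∈ S, z ≠ 0 := fun z hz h => by
    have := hSm z hz
    rw [h, norm_zero] at this
    linarith
  have hT0 : (T : ℂ) ≠ 0 := by exact_mod_cast hT.ne'
  have hexp : ∀ z ∈ S, ‖Complex.exp (-(T * z))‖ ≤ 1 := fun z hz => by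
    rw [Complex.norm_exp, Real.exp_le_one_iff]
    simpa using mul_nonneg hT.le (hre z hz)
  have hslit : ∀ z ∈ S, z ∈ Complex.slitPlane := fun z hz => by
    rw [Complex.mem_slitPlane_iff]
    rcases (hre z hz).lt_or_eq with h | h
    · exact Or.inl h
    · exact Or.inr fun h' => hne z hz (Complex.ext h.symm h')
  have hbd : ∀ z ∈ S, ‖Complex.exp (-(T * z)) / (T * z)‖ ≤ 1 / (T * m) := fun z hz => by
    rw [norm_div, norm_mul, Complex.norm_real, Real.norm_of_nonneg hT.le]
    gcongr
    · exact hexp z hz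
    · exact hSm z hz
  have hmv := hS.norm_image_sub_le_of_norm_hasDerivWithin_le
    (f := fun z : ℂ => (∫ t in (0 : ℝ)..T,
      (Complex.exp (-(t * z)) - Complex.exp (-(t * p))) / t) + Complex.log z +
      Complex.exp (-(T * z)) / (T * z))
    (f' := fun z => -(Complex.exp (-(T * z)) / (T * z ^ 2))) (C := 1 / (T * m ^ 2))
    (fun z hz => by
      have hz0 := hne z hz
      have d₁ := hasDerivAt_integral_exp_sub_exp_div (hre p hp) (hre z hz) hz0 hT.le
      have d₂ := Complex.hasDerivAt_log (hslit z hz)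
      have d₃ := (hasDerivAt_id z).const_mul (T : ℂ)
      have d₄ := d₃.neg.cexp.div d₃ (mul_ne_zero hT0 hz0)
      refine (((d₁.add d₂).add d₄).congr_deriv ?_).hasDerivWithinAt
      simp only [id, mul_one, Pi.neg_apply]
      field_simp
      ring)
    (fun z hz => by
      rw [norm_neg, norm_div, norm_mul, norm_pow, Complex.norm_real, Real.norm_of_nonneg hT.le]
      gcongr
      · exact hexp z hz
      · exact hSm z hz)
    hp hq
  simp only [sub_self, zero_div, intervalIntegral.integral_zero, zero_add] at hmv
  set E := ∫ t in (0 : ℝ)..T, (Complex.exp (-(t * q)) - Complex.exp (-(t * p))) / t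
  have hE : E - (Complex.log p - Complex.log q) =
      (E + Complex.log q + Complex.exp (-(T * q)) / (T * q) -
        (Complex.log p + Complex.exp (-(T * p)) / (T * p))) -
        Complex.exp (-(T * q)) / (T * q) + Complex.exp (-(T * p)) / (T * p) := by ring
  rw [hE]
  calc _ ≤ 1 / (T * m ^ 2) * ‖q - p‖ + 1 / (T * m) + 1 / (T * m) := by
        refine (norm_add_le _ _).trans ?_
        gcongr
        · refine (norm_sub_le _ _).trans ?_
          gcongr
          exact hbd q hq
        · exact hbd p hp
    _ = _ := by field_simp; ring

/-- The integrand of Malmsten's integral for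
`log (Γ(w₂) Γ(b - w₂) / (Γ(w₁) Γ(b - w₁)))`, in the variable `t` with `s = 2t`. -/
def gammaRatioIntegrand (b w₁ w₂ : ℂ) (t : ℝ) : ℂ :=
  ((Complex.exp (-(t * (2 * w₂))) - Complex.exp (-(t * (2 * w₁)))) / t +
    (Complex.exp (-(t * (2 * (b - w₂)))) - Complex.exp (-(t * (2 * (b - w₁))))) / t) /
    (1 - Complex.exp (-(2 * t)))

theorem one_sub_exp_neg_two_mul_ne_zero {t : ℝ} (ht : 0 < t) :
    1 - Complex.exp (-(2 * t)) ≠ 0 := by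
  rw [sub_ne_zero, show -(2 * (t : ℂ)) = ((-(2 * t) : ℝ) : ℂ) by push_cast; rfl,
    ← Complex.ofReal_exp]
  intro h
  have h : (1 : ℝ) = Real.exp (-(2 * t)) := by exact_mod_cast h
  have := Real.exp_lt_one_iff.2 (show -(2 * t) < 0 by linarith)
  linarith

theorem Iintegrand_add_Jintegrand (N : ℕ) (θ : ℂ) {t : ℝ} (ht : 0 < t) :
    Iintegrand N (-θ) t + Jintegrand N (I * Real.pi + θ) t =
      Complex.exp (t / N) * (Complex.sinh (t * (1 - 1 / N)) + Complex.sinh (t / N)) /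
        (t * Complex.sinh t ^ 2) -
      (Complex.exp (-(t * (2 * (-θ / (2 * Real.pi * I))))) +
        Complex.exp (-(t * (2 * (1 - 1 / N - -θ / (2 * Real.pi * I)))))) /
        (t * (1 - Complex.exp (-(2 * t)))) := by
  have ht0 : (t : ℂ) ≠ 0 := by exact_mod_cast ht.ne'
  have hπ : (Real.pi : ℂ) ≠ 0 := by exact_mod_cast Real.pi_ne_zero
  have hD := one_sub_exp_neg_two_mul_ne_zero ht
  set z : ℂ := 2 * (-θ / (2 * Real.pi * I)) with hz
  have c₁ : (t : ℂ) * (1 - -θ / (I * Real.pi)) = t + -(t * z) := by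
    rw [hz]; field_simp; ring
  have c₂ : (t : ℂ) * (1 - (I * Real.pi + θ) / (I * Real.pi)) = t * z := by
    rw [hz]; field_simp; ring
  have c₃ : -((t : ℂ) * (2 * (1 - 1 / N - -θ / (2 * Real.pi * I)))) =
      -t + -t + t / N + t / N + t * z := by
    rw [hz]; ring
  have c₄ : (t : ℂ) * (1 - 1 / N) = t + -(t / N) := by ring
  have c₅ : -(2 * (t : ℂ)) = -t + -t := by ring
  rw [c₅] at hD
  rw [Iintegrand, Jintegrand, c₁, c₂, c₃, c₄, c₅]
  simp only [Complex.sinh, Complex.cosh, neg_add, neg_neg, Complex.exp_add, Complex.exp_neg]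
    at hD ⊢
  have hE := Complex.exp_ne_zero t
  have hA := Complex.exp_ne_zero (t / N)
  have hZ := Complex.exp_ne_zero (t * z)
  set E := Complex.exp t
  set A := Complex.exp (t / N)
  set Z := Complex.exp (t * z)
  have hE2 : E ^ 2 - 1 ≠ 0 := by
    intro h
    apply hD
    field_simp
    linear_combination h
  have e₁ : (E - E⁻¹) / 2 = (E ^ 2 - 1) / (2 * E) := by field_simp
  have e₂ : 1 - E⁻¹ * E⁻¹ = (E ^ 2 - 1) / E ^ 2 := by field_simp
  rw [e₁, e₂]
  field_simp
  ring

theorem Iintegrand_add_Jintegrand_sub (N : ℕ) (θ₁ θ₂ : ℂ) {t : ℝ} (ht : 0 < t) :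
    Iintegrand N (-θ₁) t + Jintegrand N (I * Real.pi + θ₁) t -
      (Iintegrand N (-θ₂) t + Jintegrand N (I * Real.pi + θ₂) t) =
    gammaRatioIntegrand (1 - 1 / N) (-θ₁ / (2 * Real.pi * I)) (-θ₂ / (2 * Real.pi * I)) t := by
  rw [Iintegrand_add_Jintegrand N θ₁ ht, Iintegrand_add_Jintegrand N θ₂ ht, gammaRatioIntegrand,
    ← add_div, div_div]
  ring

theorem norm_gammaRatioIntegrand_le {b w₁ w₂ : ℂ} (hw₁ : w₁.re = 0) (hw₂ : w₂.re = 0)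
    (hb : 0 < b.re) {t : ℝ} (ht : 0 < t) :
    ‖gammaRatioIntegrand b w₁ w₂ t‖ ≤
      2 * ‖w₂ - w₁‖ * ‖b - w₁ - w₂‖ * Real.exp (2 * t) := by
  have hnum : (Complex.exp (-(t * (2 * w₂))) - Complex.exp (-(t * (2 * w₁)))) / t +
      (Complex.exp (-(t * (2 * (b - w₂)))) - Complex.exp (-(t * (2 * (b - w₁))))) / t =
      (Complex.exp (-(t * (2 * w₂))) - Complex.exp (-(t * (2 * w₁)))) *
        (Complex.exp (-0) - Complex.exp (-(t * (2 * (b - w₁ - w₂))))) / t := by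
    rw [← add_div]
    congr 1
    have e₂ : -((t : ℂ) * (2 * (b - w₂))) = -(t * (2 * (b - w₁ - w₂))) + -(t * (2 * w₁)) := by
      ring
    have e₁ : -((t : ℂ) * (2 * (b - w₁))) = -(t * (2 * (b - w₁ - w₂))) + -(t * (2 * w₂)) := by
      ring
    rw [e₁, e₂, Complex.exp_add, Complex.exp_add, neg_zero, Complex.exp_zero]
    ring
  have h₁ := norm_exp_neg_sub_exp_neg_le (z := t * (2 * w₂)) (w := t * (2 * w₁))
    (by simp [hw₂]) (by simp [hw₁])
  have h₂ := norm_exp_neg_sub_exp_neg_le (z := 0) (w := t * (2 * (b - w₁ - w₂)))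
    (by simp) (by simp [hw₁, hw₂]; positivity)
  rw [← mul_sub, ← mul_sub, norm_mul, norm_mul, Complex.norm_real, Real.norm_of_nonneg ht.le,
    Complex.norm_ofNat] at h₁
  rw [zero_sub, norm_neg, norm_mul, norm_mul, Complex.norm_real, Real.norm_of_nonneg ht.le,
    Complex.norm_ofNat] at h₂
  have h₃ := le_one_add_mul_one_sub_exp_neg (s := 2 * t) (by positivity)
  have hpos : 0 < 1 - Real.exp (-(2 * t)) :=
    sub_pos.2 (Real.exp_lt_one_iff.2 (by linarith))
  have h₄ : 2 * t ≤ Real.exp (2 * t) * (1 - Real.exp (-(2 * t))) := by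
    refine h₃.trans ?_
    gcongr
    linarith [Real.add_one_le_exp (2 * t)]
  have h₅ : ‖1 - Complex.exp (-(2 * t))‖ = 1 - Real.exp (-(2 * t)) := by
    rw [show -(2 * (t : ℂ)) = ((-(2 * t) : ℝ) : ℂ) by push_cast; rfl, ← Complex.ofReal_exp,
      ← Complex.ofReal_one, ← Complex.ofReal_sub, Complex.norm_real, Real.norm_of_nonneg hpos.le]
  rw [gammaRatioIntegrand, hnum, norm_div, norm_div, norm_mul, Complex.norm_real,
    Real.norm_of_nonneg ht.le, h₅, div_div, div_le_iff₀ (by positivity)]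
  calc _ ≤ t * (2 * ‖w₂ - w₁‖) * (t * (2 * ‖b - w₁ - w₂‖)) := by gcongr
    _ = 2 * ‖w₂ - w₁‖ * ‖b - w₁ - w₂‖ * t * (2 * t) := by ring
    _ ≤ 2 * ‖w₂ - w₁‖ * ‖b - w₁ - w₂‖ * t *
          (Real.exp (2 * t) * (1 - Real.exp (-(2 * t)))) := by gcongr
    _ = _ := by ring

theorem gammaRatioIntegrand_eq_sum_add (b w₁ w₂ : ℂ) {t : ℝ} (ht : 0 < t) (n : ℕ) :
    gammaRatioIntegrand b w₁ w₂ t =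
      ∑ k ∈ Finset.range n,
        ((Complex.exp (-(t * (2 * (w₂ + k)))) - Complex.exp (-(t * (2 * (w₁ + k))))) / t +
        (Complex.exp (-(t * (2 * (b - w₂ + k)))) -
          Complex.exp (-(t * (2 * (b - w₁ + k))))) / t) +
      Complex.exp (-(2 * t) * n) * gammaRatioIntegrand b w₁ w₂ t := by
  have hD := one_sub_exp_neg_two_mul_ne_zero ht
  induction n with
  | zero => simp
  | succ n ih =>
    have hs : ∀ u : ℂ, Complex.exp (-(t * (2 * (u + n)))) =
        Complex.exp (-(2 * t) * n) * Complex.exp (-(t * (2 * u))) := fun u => by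
      rw [← Complex.exp_add]; ring_nf
    have he : Complex.exp (-(2 * t) * (n + 1 : ℕ)) =
        Complex.exp (-(2 * t) * n) * Complex.exp (-(2 * t)) := by
      rw [← Complex.exp_add]; push_cast; ring_nf
    have hg : gammaRatioIntegrand b w₁ w₂ t * (1 - Complex.exp (-(2 * t))) =
        (Complex.exp (-(t * (2 * w₂))) - Complex.exp (-(t * (2 * w₁)))) / t +
        (Complex.exp (-(t * (2 * (b - w₂)))) - Complex.exp (-(t * (2 * (b - w₁))))) / t := by
      rw [gammaRatioIntegrand, div_mul_cancel₀ _ hD]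
    rw [Finset.sum_range_succ, he, hs, hs, hs, hs]
    linear_combination ih + Complex.exp (-(2 * t) * n) * hg

/-- The logarithm of the `k`-th factor of Euler's product for
`Γ(w₂) Γ(b - w₂) / (Γ(w₁) Γ(b - w₁))`. -/
def gammaRatioLogFactor (b w₁ w₂ : ℂ) (k : ℕ) : ℂ :=
  (Complex.log (2 * (w₁ + k)) - Complex.log (2 * (w₂ + k))) +
    (Complex.log (2 * (b - w₁ + k)) - Complex.log (2 * (b - w₂ + k)))

theorem tendsto_integral_gammaRatio_term {b w₁ w₂ : ℂ} (hw₁ : w₁.re = 0) (hw₂ : w₂.re = 0)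
    (hi₁ : 0 < w₁.im) (hi₂ : 0 < w₂.im) (hb : 0 < b.re) (k : ℕ) :
    Tendsto (fun T : ℝ => ∫ t in (0 : ℝ)..T,
      ((Complex.exp (-(t * (2 * (w₂ + k)))) - Complex.exp (-(t * (2 * (w₁ + k))))) / t +
      (Complex.exp (-(t * (2 * (b - w₂ + k)))) - Complex.exp (-(t * (2 * (b - w₁ + k))))) / t))
      atTop (nhds (gammaRatioLogFactor b w₁ w₂ k)) := by
  have h₁ := tendsto_integral_exp_sub_exp_div (S := {z : ℂ | 0 ≤ z.re} ∩
      {z : ℂ | min w₁.im w₂.im ≤ z.im})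
    ((convex_halfSpace_re_ge 0).inter (convex_halfSpace_im_ge _)) (lt_min hi₁ hi₂)
    (fun z hz => hz.2.trans (Complex.im_le_norm z)) (fun z hz => hz.1)
    (p := 2 * (w₁ + k)) (q := 2 * (w₂ + k))
    ⟨by simp [hw₁], (min_le_left _ _).trans
      (show w₁.im ≤ (2 * (w₁ + k)).im by simp; linarith)⟩
    ⟨by simp [hw₂], (min_le_right _ _).trans
      (show w₂.im ≤ (2 * (w₂ + k)).im by simp; linarith)⟩
  have h₂ := tendsto_integral_exp_sub_exp_div (S := {z : ℂ | b.re ≤ z.re})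
    (convex_halfSpace_re_ge _) hb (fun z hz => hz.trans (Complex.re_le_norm z))
    (fun z hz => hb.le.trans hz)
    (p := 2 * (b - w₁ + k)) (q := 2 * (b - w₂ + k))
    (by simp [hw₁]; linarith [Nat.cast_nonneg (α := ℝ) k])
    (by simp [hw₂]; linarith [Nat.cast_nonneg (α := ℝ) k])
  refine (h₁.add h₂).congr' ?_
  filter_upwards [eventually_ge_atTop 0] with T hT
  rw [← intervalIntegral.integral_add]
  · exact intervalIntegrable_exp_sub_exp_div (by simp [hw₁]) (by simp [hw₂]) hT
  · exact intervalIntegrable_exp_sub_exp_div (by simp [hw₁]; positivity)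
      (by simp [hw₂]; positivity) hT

theorem norm_integral_exp_mul_gammaRatioIntegrand_le {b w₁ w₂ : ℂ} (hw₁ : w₁.re = 0)
    (hw₂ : w₂.re = 0) (hb : 0 < b.re) {n : ℕ} (hn : 0 < n) {T : ℝ} (hT : 0 ≤ T) :
    ‖∫ t in (0 : ℝ)..T, Complex.exp (-(2 * t) * (n + 1 : ℕ)) * gammaRatioIntegrand b w₁ w₂ t‖ ≤
      2 * ‖w₂ - w₁‖ * ‖b - w₁ - w₂‖ / n := by
  set C := 2 * ‖w₂ - w₁‖ * ‖b - w₁ - w₂‖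
  have hn' : (0 : ℝ) < n := by exact_mod_cast hn
  refine (intervalIntegral.norm_integral_le_of_norm_le hT
    (g := fun t => C * Real.exp (-(2 * n) * t)) (ae_of_all _ fun t ht => ?_)
    (Continuous.intervalIntegrable (by fun_prop) _ _)).trans ?_
  · rw [norm_mul, show -(2 * (t : ℂ)) * (n + 1 : ℕ) = ((-(2 * t) * (n + 1) : ℝ) : ℂ) by
      push_cast; rfl, ← Complex.ofReal_exp, Complex.norm_real,
      Real.norm_of_nonneg (Real.exp_pos _).le]
    have e : Real.exp (-(2 * n) * t) = Real.exp (-(2 * t) * (n + 1)) * Real.exp (2 * t) := by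
      rw [← Real.exp_add]; ring_nf
    rw [e, ← mul_assoc, mul_comm C, mul_assoc]
    gcongr
    exact norm_gammaRatioIntegrand_le hw₁ hw₂ hb ht.1
  · rw [intervalIntegral.integral_const_mul, div_eq_mul_inv]
    gcongr
    rw [intervalIntegral.integral_comp_mul_left (fun x => Real.exp x) (by linarith),
      integral_exp, smul_eq_mul, mul_zero, Real.exp_zero]
    have := Real.exp_pos (-(2 * n) * T)
    rw [neg_inv.symm, neg_mul, ← mul_neg, neg_sub, mul_inv]
    have : (n : ℝ)⁻¹ > 0 := by positivity
    nlinarith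

theorem tendsto_sum_gammaRatioLogFactor {b w₁ w₂ D : ℂ} (hw₁ : w₁.re = 0) (hw₂ : w₂.re = 0)
    (hi₁ : 0 < w₁.im) (hi₂ : 0 < w₂.im) (hb : 0 < b.re)
    (hD : Tendsto (fun T : ℝ => ∫ t in (0 : ℝ)..T, gammaRatioIntegrand b w₁ w₂ t) atTop (nhds D)) :
    Tendsto (fun n : ℕ => ∑ k ∈ Finset.range (n + 1), gammaRatioLogFactor b w₁ w₂ k)
      atTop (nhds D) := by
  rw [tendsto_iff_norm_sub_tendsto_zero]
  refine squeeze_zero' (g := fun n : ℕ => 2 * ‖w₂ - w₁‖ * ‖b - w₁ - w₂‖ / (n : ℝ))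
    (Eventually.of_forall fun _ => norm_nonneg _) ?_
    (tendsto_const_nhds.div_atTop tendsto_natCast_atTop_atTop)
  filter_upwards [eventually_gt_atTop 0] with n hn
  rw [norm_sub_rev]
  refine le_of_tendsto (hD.sub (tendsto_finsetSum (Finset.range (n + 1)) fun k _ =>
    tendsto_integral_gammaRatio_term hw₁ hw₂ hi₁ hi₂ hb k)).norm ?_
  filter_upwards [eventually_ge_atTop 0] with T hT
  have hterm : ∀ k ∈ Finset.range (n + 1), IntervalIntegrable (fun t : ℝ =>
      (Complex.exp (-(t * (2 * (w₂ + k)))) - Complex.exp (-(t * (2 * (w₁ + k))))) / t +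
      (Complex.exp (-(t * (2 * (b - w₂ + k)))) -
        Complex.exp (-(t * (2 * (b - w₁ + k))))) / t) volume 0 T := fun k _ =>
    (intervalIntegrable_exp_sub_exp_div (by simp [hw₁]) (by simp [hw₂]) hT).add
      (intervalIntegrable_exp_sub_exp_div (by simp [hw₁]; positivity)
        (by simp [hw₂]; positivity) hT)
  have hint : IntervalIntegrable (gammaRatioIntegrand b w₁ w₂) volume 0 T := by
    refine intervalIntegrable_of_norm_le hT
      (C := 2 * ‖w₂ - w₁‖ * ‖b - w₁ - w₂‖ * Real.exp (2 * T))
      (by unfold gammaRatioIntegrand; fun_prop) fun t ht => ?_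
    refine (norm_gammaRatioIntegrand_le hw₁ hw₂ hb ht.1).trans ?_
    have := ht.2
    gcongr
  rw [← intervalIntegral.integral_finsetSum hterm, ← intervalIntegral.integral_sub hint
    (by simpa only [Finset.sum_fn] using IntervalIntegrable.sum _ hterm)]
  refine le_trans (le_of_eq ?_)
    (norm_integral_exp_mul_gammaRatioIntegrand_le hw₁ hw₂ hb hn hT)
  congr 1
  refine intervalIntegral.integral_congr_ae (ae_of_all _ fun t ht => ?_)
  rw [Set.uIoc_of_le hT] at ht
  have := gammaRatioIntegrand_eq_sum_add b w₁ w₂ ht.1 (n + 1)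
  linear_combination this

theorem exp_mul_GammaSeq_mul_GammaSeq {b w₁ w₂ : ℂ} (hw₁ : ∀ k : ℕ, w₁ + k ≠ 0)
    (hw₂ : ∀ k : ℕ, w₂ + k ≠ 0) (hv₁ : ∀ k : ℕ, b - w₁ + k ≠ 0)
    (hv₂ : ∀ k : ℕ, b - w₂ + k ≠ 0) {n : ℕ} (hn : n ≠ 0) :
    Complex.exp (∑ k ∈ Finset.range (n + 1), gammaRatioLogFactor b w₁ w₂ k) *
      (Complex.GammaSeq w₁ n * Complex.GammaSeq (b - w₁) n) =
      Complex.GammaSeq w₂ n * Complex.GammaSeq (b - w₂) n := by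
  have hfac : ∀ k : ℕ, Complex.exp (gammaRatioLogFactor b w₁ w₂ k) =
      (w₁ + k) * (b - w₁ + k) / ((w₂ + k) * (b - w₂ + k)) := fun k => by
    have := hw₂ k
    have := hv₂ k
    rw [gammaRatioLogFactor, Complex.exp_add, Complex.exp_sub, Complex.exp_sub,
      Complex.exp_log (mul_ne_zero two_ne_zero (hw₁ k)),
      Complex.exp_log (mul_ne_zero two_ne_zero (hw₂ k)),
      Complex.exp_log (mul_ne_zero two_ne_zero (hv₁ k)),
      Complex.exp_log (mul_ne_zero two_ne_zero (hv₂ k))]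
    field_simp
  have hpow : ∀ w : ℂ, (n : ℂ) ^ w * (n : ℂ) ^ (b - w) = (n : ℂ) ^ b := fun w => by
    rw [← Complex.cpow_add _ _ (Nat.cast_ne_zero.2 hn), add_sub_cancel]
  rw [Complex.exp_sum, Finset.prod_congr rfl fun k _ => hfac k, Finset.prod_div_distrib,
    Finset.prod_mul_distrib, Finset.prod_mul_distrib]
  simp only [Complex.GammaSeq]
  have p₁ := Finset.prod_ne_zero_iff.2 fun k (_ : k ∈ Finset.range (n + 1)) => hw₁ k
  have p₂ := Finset.prod_ne_zero_iff.2 fun k (_ : k ∈ Finset.range (n + 1)) => hw₂ k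
  have p₃ := Finset.prod_ne_zero_iff.2 fun k (_ : k ∈ Finset.range (n + 1)) => hv₁ k
  have p₄ := Finset.prod_ne_zero_iff.2 fun k (_ : k ∈ Finset.range (n + 1)) => hv₂ k
  have h := (hpow w₁).trans (hpow w₂).symm
  generalize (n : ℂ) ^ w₁ = x₁ at *
  generalize (n : ℂ) ^ (b - w₁) = x₂ at *
  generalize (n : ℂ) ^ w₂ = x₃ at *
  generalize (n : ℂ) ^ (b - w₂) = x₄ at *
  field_simp
  linear_combination (n.factorial : ℂ) ^ 2 * h

theorem exp_mul_Gamma_mul_Gamma {b w₁ w₂ D : ℂ} (hw₁ : w₁.re = 0) (hw₂ : w₂.re = 0)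
    (hi₁ : 0 < w₁.im) (hi₂ : 0 < w₂.im) (hb : 0 < b.re)
    (hD : Tendsto (fun T : ℝ => ∫ t in (0 : ℝ)..T, gammaRatioIntegrand b w₁ w₂ t) atTop (nhds D)) :
    Complex.exp D * (Complex.Gamma w₁ * Complex.Gamma (b - w₁)) =
      Complex.Gamma w₂ * Complex.Gamma (b - w₂) := by
  have hw : ∀ w : ℂ, 0 < w.im → ∀ k : ℕ, w + k ≠ 0 := fun w hi k h => by
    have := congrArg Complex.im h
    simp at this
    linarith
  have hv : ∀ w : ℂ, w.re = 0 → ∀ k : ℕ, b - w + k ≠ 0 := fun w hr k h => by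
    have := congrArg Complex.re h
    simp [hr] at this
    linarith [Nat.cast_nonneg (α := ℝ) k]
  have hL := ((tendsto_sum_gammaRatioLogFactor hw₁ hw₂ hi₁ hi₂ hb hD).cexp).mul
    ((Complex.GammaSeq_tendsto_Gamma w₁).mul (Complex.GammaSeq_tendsto_Gamma (b - w₁)))
  refine tendsto_nhds_unique (hL.congr' ?_)
    ((Complex.GammaSeq_tendsto_Gamma w₂).mul (Complex.GammaSeq_tendsto_Gamma (b - w₂)))
  filter_upwards [eventually_ne_atTop 0] with n hn
  exact exp_mul_GammaSeq_mul_GammaSeq (hw w₁ hi₁) (hw w₂ hi₂) (hv w₁ hw₁) (hv w₂ hw₂) hn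

/-- `F(−θ)·G(iπ+θ)·φ̃(θ)` is independent of `θ` on the positive real axis, i.e.
`φ̃(θ) = const/(F(−θ)G(iπ+θ))`:
with `I(−θ)` the improper limit `A` of `∫₀^T` of its integrand and
`J(iπ+θ)` the (absolutely convergent) integral `B`, the value
`exp(A + B)·φ̃(θ)` is the same for all real `θ > 0`. -/
theorem suN_phi_function_identity (N : ℕ) (hN : 2 ≤ N)
    (θ₁ θ₂ : ℝ) (hθ₁ : 0 < θ₁) (hθ₂ : 0 < θ₂)
    (A₁ A₂ B₁ B₂ : ℂ)
    (hA₁ : Tendsto (fun T : ℝ => ∫ t in (0 : ℝ)..T, Iintegrand N (-(θ₁ : ℂ)) t)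
      atTop (nhds A₁))
    (hA₂ : Tendsto (fun T : ℝ => ∫ t in (0 : ℝ)..T, Iintegrand N (-(θ₂ : ℂ)) t)
      atTop (nhds A₂))
    (hB₁ : B₁ = ∫ t in Set.Ioi (0 : ℝ), Jintegrand N (I * Real.pi + θ₁) t)
    (hB₂ : B₂ = ∫ t in Set.Ioi (0 : ℝ), Jintegrand N (I * Real.pi + θ₂) t) :
    Complex.exp (A₁ + B₁) * phiTilde N θ₁ = Complex.exp (A₂ + B₂) * phiTilde N θ₂ := by
  have hw : ∀ θ : ℝ, -(θ : ℂ) / (2 * Real.pi * I) = ((θ / (2 * Real.pi) : ℝ) : ℂ) * I := by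
    intro θ
    have hπ : (Real.pi : ℂ) ≠ 0 := by exact_mod_cast Real.pi_ne_zero
    push_cast
    field_simp
    rw [I_sq, mul_neg_one]
  have hJ : ∀ θ : ℝ, Tendsto (fun T : ℝ => ∫ t in (0 : ℝ)..T, Jintegrand N (I * Real.pi + θ) t)
      atTop (nhds (∫ t in Set.Ioi (0 : ℝ), Jintegrand N (I * Real.pi + θ) t)) := fun θ =>
    intervalIntegral_tendsto_integral_Ioi 0 (integrableOn_Jintegrand N hN θ) tendsto_id
  have hD := (hA₁.add (hB₁ ▸ hJ θ₁)).sub (hA₂.add (hB₂ ▸ hJ θ₂))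
  have hD' : Tendsto (fun T : ℝ => ∫ t in (0 : ℝ)..T, gammaRatioIntegrand (1 - 1 / N)
      (-(θ₁ : ℂ) / (2 * Real.pi * I)) (-(θ₂ : ℂ) / (2 * Real.pi * I)) t) atTop
      (nhds (A₁ + B₁ - (A₂ + B₂))) := by
    refine hD.congr' ?_
    filter_upwards [eventually_ge_atTop 0] with T hT
    have i₁ := intervalIntegrable_Iintegrand N (-(θ₁ : ℂ)) hT
    have i₂ := intervalIntegrable_Iintegrand N (-(θ₂ : ℂ)) hT
    have j₁ := intervalIntegrable_Jintegrand N (I * Real.pi + θ₁) hT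
    have j₂ := intervalIntegrable_Jintegrand N (I * Real.pi + θ₂) hT
    rw [← intervalIntegral.integral_add i₁ j₁, ← intervalIntegral.integral_add i₂ j₂,
      ← intervalIntegral.integral_sub (i₁.add j₁) (i₂.add j₂)]
    refine intervalIntegral.integral_congr_ae (ae_of_all _ fun t ht => ?_)
    rw [Set.uIoc_of_le hT] at ht
    exact Iintegrand_add_Jintegrand_sub N θ₁ θ₂ ht.1
  have hb : 0 < (1 - 1 / (N : ℂ)).re := by
    have h2 : (2 : ℝ) ≤ N := by exact_mod_cast hN
    have : (1 - 1 / (N : ℂ)) = ((1 - 1 / N : ℝ) : ℂ) := by push_cast; rfl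
    rw [this, Complex.ofReal_re, sub_pos, div_lt_one (by linarith)]
    linarith
  have key := exp_mul_Gamma_mul_Gamma
    (by rw [hw, Complex.re_ofReal_mul, Complex.I_re, mul_zero])
    (by rw [hw, Complex.re_ofReal_mul, Complex.I_re, mul_zero])
    (by rw [hw, Complex.im_ofReal_mul, Complex.I_im]; positivity)
    (by rw [hw, Complex.im_ofReal_mul, Complex.I_im]; positivity) hb hD'
  have hphi : ∀ θ : ℝ, phiTilde N θ = Complex.Gamma (-(θ : ℂ) / (2 * Real.pi * I)) *
      Complex.Gamma (1 - 1 / N - -(θ : ℂ) / (2 * Real.pi * I)) := fun θ => by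
    rw [phiTilde, neg_div, sub_neg_eq_add]
  rw [hphi, hphi, ← key, ← mul_assoc (Complex.exp (A₂ + B₂)), ← Complex.exp_add]
  congr 2
  ring

end
end

section
/- For every real x with |x| < 1, the integral ∫₀^∞ (1 − cosh(x·t)) / (t·sinh t) dt is absolutely convergent and equals log(cos(πx/2)). -/
open MeasureTheory

open Filter Topology Set in
theorem integral_Ioi_exp_neg_sub_exp_neg_div {a b : ℝ} (ha : 0 < a) (hb : 0 < b) :
    IntegrableOn (fun t : ℝ => t⁻¹ • (Real.exp (-(a * t)) - Real.exp (-(b * t)))) (Ioi 0) ∧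
      ∫ t in Ioi (0 : ℝ), t⁻¹ • (Real.exp (-(a * t)) - Real.exp (-(b * t))) =
        Real.log (b / a) := by
  have bound : ∀ {c d t : ℝ}, 0 < t →
      Real.exp (-(c * t)) - Real.exp (-(d * t)) ≤ (d - c) * t * Real.exp (-(c * t)) := by
    intro c d t _
    have h1 : Real.exp (-(d * t)) = Real.exp (-(c * t)) * Real.exp (-((d - c) * t)) := by
      rw [← Real.exp_add]; ring_nf
    have h2 := Real.add_one_le_exp (-((d - c) * t))
    nlinarith [Real.exp_pos (-(c * t))]
  have hint : IntegrableOn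
      (fun t : ℝ => t⁻¹ • (Real.exp (-(a * t)) - Real.exp (-(b * t)))) (Ioi 0) := by
    have hexp : IntegrableOn (fun t : ℝ => |b - a| * (Real.exp (-a * t) + Real.exp (-b * t)))
        (Ioi 0) :=
      ((integrableOn_exp_mul_Ioi (neg_lt_zero.2 ha) 0).add
        (integrableOn_exp_mul_Ioi (neg_lt_zero.2 hb) 0)).const_mul _
    refine hexp.mono' (by fun_prop) ?_
    filter_upwards [ae_restrict_mem measurableSet_Ioi] with t (ht : 0 < t)
    rw [norm_smul, norm_inv, Real.norm_of_nonneg ht.le, inv_mul_le_iff₀ ht, Real.norm_eq_abs,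
      neg_mul, neg_mul, abs_le]
    have h1 := bound (c := a) (d := b) ht
    have h2 := bound (c := b) (d := a) ht
    have ea := mul_pos ht (Real.exp_pos (-(a * t)))
    have eb := mul_pos ht (Real.exp_pos (-(b * t)))
    constructor <;> nlinarith [le_abs_self (b - a), neg_abs_le (b - a), abs_nonneg (b - a)]
  refine ⟨hint, ?_⟩
  have hcont : Continuous fun t : ℝ => Real.exp (-t) := by fun_prop
  have := Frullani.integral_Ioi_eq (f := fun t : ℝ => Real.exp (-t)) (L := 1) (R := 0)
    (hcont.locallyIntegrable.locallyIntegrableOn _) ha hb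
    (by simpa using (hcont.tendsto 0).mono_left nhdsWithin_le_nhds)
    (Real.tendsto_exp_neg_atTop_nhds_zero) hint
  simpa using this

open Filter Topology Set in
theorem integral_Ioi_exp_neg_mul_one_sub_cosh_div {a x : ℝ} (hx : |x| < a) :
    IntegrableOn (fun t : ℝ => 2 * Real.exp (-(a * t)) * ((1 - Real.cosh (x * t)) / t)) (Ioi 0) ∧
      ∫ t in Ioi (0 : ℝ), 2 * Real.exp (-(a * t)) * ((1 - Real.cosh (x * t)) / t) =
        Real.log (1 - x ^ 2 / a ^ 2) := by
  obtain ⟨h1, h2⟩ := abs_lt.1 hx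
  have ha : 0 < a := (abs_nonneg x).trans_lt hx
  have hp : 0 < a + x := by linarith
  have hm : 0 < a - x := by linarith
  obtain ⟨i1, e1⟩ := integral_Ioi_exp_neg_sub_exp_neg_div ha hp
  obtain ⟨i2, e2⟩ := integral_Ioi_exp_neg_sub_exp_neg_div ha hm
  have heq : (fun t : ℝ => 2 * Real.exp (-(a * t)) * ((1 - Real.cosh (x * t)) / t)) =
      fun t => t⁻¹ • (Real.exp (-(a * t)) - Real.exp (-((a + x) * t))) +
        t⁻¹ • (Real.exp (-(a * t)) - Real.exp (-((a - x) * t))) := by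
    ext t
    have ep : Real.exp (-((a + x) * t)) = Real.exp (-(a * t)) * Real.exp (-(x * t)) := by
      rw [← Real.exp_add]; ring_nf
    have em : Real.exp (-((a - x) * t)) = Real.exp (-(a * t)) * Real.exp (x * t) := by
      rw [← Real.exp_add]; ring_nf
    rw [ep, em, Real.cosh_eq]
    simp only [smul_eq_mul]
    ring
  rw [heq]
  refine ⟨i1.add i2, ?_⟩
  rw [integral_add i1 i2, e1, e2, ← Real.log_mul (by positivity) (by positivity)]
  congr 1
  field_simp
  ring

open Filter Topology Finset in
theorem tendsto_prod_one_sub_sq_div_odd_sq {x : ℝ} (hx : |x| < 1) :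
    Tendsto (fun n : ℕ => ∏ j ∈ range n, (1 - x ^ 2 / (2 * (j : ℝ) + 1) ^ 2)) atTop
      (𝓝 (Real.cos (Real.pi * x / 2))) := by
  rcases eq_or_ne x 0 with rfl | h0
  · simp
  have hxl := abs_lt.1 hx
  have hsin : Real.sin (Real.pi * (x / 2)) ≠ 0 := by
    rcases lt_or_gt_of_ne h0 with h | h
    · exact (Real.sin_neg_of_neg_of_neg_pi_lt (by nlinarith [Real.pi_pos])
        (by nlinarith [Real.pi_pos])).ne
    · exact (Real.sin_pos_of_pos_of_lt_pi (by positivity) (by nlinarith [Real.pi_pos])).ne'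
  have hsplit : ∀ n : ℕ, ∏ j ∈ range (2 * n), (1 - x ^ 2 / ((j : ℝ) + 1) ^ 2) =
      (∏ j ∈ range n, (1 - x ^ 2 / (2 * (j : ℝ) + 1) ^ 2)) *
        ∏ j ∈ range n, (1 - (x / 2) ^ 2 / ((j : ℝ) + 1) ^ 2) := by
    intro n
    induction n with
    | zero => simp
    | succ n ih =>
      rw [show 2 * (n + 1) = 2 * n + 1 + 1 by ring, prod_range_succ, prod_range_succ, ih,
        prod_range_succ, prod_range_succ]
      have : x ^ 2 / (((2 * n + 1 : ℕ) : ℝ) + 1) ^ 2 = (x / 2) ^ 2 / ((n : ℝ) + 1) ^ 2 := by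
        push_cast
        field_simp
        ring
      rw [this]
      push_cast
      ring
  have hdouble := (Real.tendsto_euler_sin_prod x).comp
    (tendsto_id.const_mul_atTop' (zero_lt_two (α := ℕ)))
  have hlim := (hdouble.div (Real.tendsto_euler_sin_prod (x / 2)) hsin).div_const 2
  have hval : Real.sin (Real.pi * x) / Real.sin (Real.pi * (x / 2)) / 2 =
      Real.cos (Real.pi * x / 2) := by
    rw [show Real.pi * x = 2 * (Real.pi * (x / 2)) by ring, Real.sin_two_mul]
    generalize Real.pi * (x / 2) = y at hsin
    field_simp
  rw [hval] at hlim
  refine hlim.congr fun n => ?_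
  have hne : ∏ j ∈ range n, (1 - (x / 2) ^ 2 / ((j : ℝ) + 1) ^ 2) ≠ 0 := by
    refine prod_ne_zero_iff.2 fun j _ => ?_
    have hj : (0 : ℝ) ≤ j := j.cast_nonneg
    have : (x / 2) ^ 2 / ((j : ℝ) + 1) ^ 2 < 1 := by
      rw [div_lt_one (by positivity)]
      nlinarith
    linarith
  simp only [Function.comp_apply, id_eq, Pi.div_apply]
  rw [hsplit]
  generalize ∏ j ∈ range n, (1 - (x / 2) ^ 2 / ((j : ℝ) + 1) ^ 2) = q at hne
  field_simp

theorem hasSum_two_mul_exp_neg_odd_mul {t : ℝ} (ht : 0 < t) :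
    HasSum (fun n : ℕ => 2 * Real.exp (-((2 * (n : ℝ) + 1) * t))) (Real.sinh t)⁻¹ := by
  have hlt : Real.exp (-(2 * t)) < 1 := Real.exp_lt_one_iff.2 (by linarith)
  have h := (hasSum_geometric_of_lt_one (Real.exp_pos _).le hlt).mul_left (2 * Real.exp (-t))
  have hval : 2 * Real.exp (-t) * (1 - Real.exp (-(2 * t)))⁻¹ = (Real.sinh t)⁻¹ := by
    have h1 : Real.exp (-(2 * t)) = Real.exp (-t) * Real.exp (-t) := by
      rw [← Real.exp_add]; ring_nf
    have h2 : Real.exp t * Real.exp (-t) = 1 := by rw [← Real.exp_add]; simp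
    have h3 : 1 - Real.exp (-(2 * t)) = 2 * Real.exp (-t) * Real.sinh t := by
      rw [Real.sinh_eq, h1]
      linear_combination -h2
    have h4 := (Real.sinh_pos_iff.2 ht).ne'
    rw [h3]
    field_simp
  rw [hval] at h
  convert! h using 1
  ext n
  rw [← Real.exp_nat_mul, mul_assoc, ← Real.exp_add]
  ring_nf

/-- For `|x| < 1`, `∫₀^∞ (1 − cosh(x·t))/(t·sinh t) dt = log(cos(πx/2))`,
the integral being absolutely convergent. -/
theorem integral_one_sub_cosh_div_t_sinh (x : ℝ) (hx : |x| < 1) :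
    IntegrableOn (fun t : ℝ => (1 - Real.cosh (x * t)) / (t * Real.sinh t))
      (Set.Ioi 0) ∧
    (∫ t in Set.Ioi (0 : ℝ), (1 - Real.cosh (x * t)) / (t * Real.sinh t)) =
      Real.log (Real.cos (Real.pi * x / 2)) := by
  rcases eq_or_ne x 0 with rfl | h0
  · simp
  have hxl := abs_lt.1 hx
  have hcos : 0 < Real.cos (Real.pi * x / 2) :=
    Real.cos_pos_of_mem_Ioo ⟨by nlinarith [Real.pi_pos], by nlinarith [Real.pi_pos]⟩
  have hlt (n : ℕ) : |x| < 2 * (n : ℝ) + 1 := by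
    have : (0 : ℝ) ≤ n := n.cast_nonneg
    linarith
  have hterm (n : ℕ) := integral_Ioi_exp_neg_mul_one_sub_cosh_div (hlt n)
  have hfactor (n : ℕ) : 0 < 1 - x ^ 2 / (2 * (n : ℝ) + 1) ^ 2 ∧
      1 - x ^ 2 / (2 * (n : ℝ) + 1) ^ 2 ≤ 1 := by
    have hpos : 0 < 2 * (n : ℝ) + 1 := (abs_nonneg x).trans_lt (hlt n)
    refine ⟨sub_pos.2 ((div_lt_one (by positivity)).2 ?_), sub_le_self _ (by positivity)⟩
    exact sq_lt_sq.2 (by rw [abs_of_pos hpos]; exact hlt n)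
  have hlog : HasSum (fun n : ℕ => -Real.log (1 - x ^ 2 / (2 * (n : ℝ) + 1) ^ 2))
      (-Real.log (Real.cos (Real.pi * x / 2))) := by
    rw [hasSum_iff_tendsto_nat_of_nonneg
      fun n => neg_nonneg.2 (Real.log_nonpos (hfactor n).1.le (hfactor n).2)]
    have h := ((tendsto_prod_one_sub_sq_div_odd_sq hx).log hcos.ne').neg
    refine h.congr fun n => ?_
    rw [Real.log_prod fun j _ => (hfactor j).1.ne', Finset.sum_neg_distrib]
  have hnorm (n : ℕ) : ∫ t in Set.Ioi (0 : ℝ),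
      ‖2 * Real.exp (-((2 * (n : ℝ) + 1) * t)) * ((1 - Real.cosh (x * t)) / t)‖ =
        -Real.log (1 - x ^ 2 / (2 * (n : ℝ) + 1) ^ 2) := by
    rw [← (hterm n).2, ← integral_neg]
    refine setIntegral_congr_fun measurableSet_Ioi fun t (ht : 0 < t) => ?_
    refine Real.norm_of_nonpos (mul_nonpos_of_nonneg_of_nonpos (by positivity) ?_)
    exact div_nonpos_of_nonpos_of_nonneg (sub_nonpos.2 (Real.one_le_cosh _)) ht.le
  have hsum := hasSum_integral_of_summable_integral_norm (fun n => (hterm n).1)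
    (by simpa only [hnorm] using hlog.summable)
  simp only [(hterm _).2] at hsum
  have hvalue : (∫ t in Set.Ioi (0 : ℝ), (1 - Real.cosh (x * t)) / (t * Real.sinh t)) =
      Real.log (Real.cos (Real.pi * x / 2)) := by
    have hlog' := hlog.neg
    simp only [neg_neg] at hlog'
    rw [hlog'.unique hsum]
    refine setIntegral_congr_fun measurableSet_Ioi fun t (ht : 0 < t) => ?_
    simp only [((hasSum_two_mul_exp_neg_odd_mul ht).mul_right _).tsum_eq]
    rw [div_mul_eq_div_div, div_eq_mul_inv _ (Real.sinh t), mul_comm]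
  refine ⟨not_imp_comm.1 integral_undef ?_, hvalue⟩
  have hcos_lt : Real.cos (Real.pi * x / 2) < 1 := by
    refine (Real.cos_le_one _).lt_of_ne fun h => h0 ?_
    rw [Real.cos_eq_one_iff_of_lt_of_lt (by nlinarith [Real.pi_pos])
      (by nlinarith [Real.pi_pos])] at h
    simpa [Real.pi_ne_zero] using h
  rw [hvalue]
  exact (Real.log_neg hcos hcos_lt).ne
end

section
/- For every real β with 0 < β < 2π and every integer N ≥ 2, the integral I_N(β) = ∫₀^∞ e^{t/N}·sinh(t(1−1/N))·(1 − cosh(t(1 − β/π))) / (t·sinh² t) dt is absolutely convergent, and as N → ∞ one has I_N(β) → ∫₀^∞ (1 − cosh(t(1 − β/π))) / (t·sinh t) dt; consequently exp(I_N(β)) → sin(β/2) as N → ∞. -/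
open MeasureTheory Filter

/-- Termwise integration of a series of nonnegative functions whose integrals are summable. -/
theorem integrable_and_integral_eq_of_hasSum_of_nonneg {α ι : Type*} [Countable ι]
    [MeasurableSpace α] {μ : Measure α} {F : ι → α → ℝ} {f : α → ℝ} {S : ℝ}
    (hf : AEStronglyMeasurable f μ) (hF : ∀ i, Integrable (F i) μ)
    (hF0 : ∀ i, 0 ≤ᵐ[μ] F i) (hsum : ∀ᵐ x ∂μ, HasSum (fun i => F i x) (f x))
    (hS : HasSum (fun i => ∫ x, F i x ∂μ) S) :
    Integrable f μ ∧ ∫ x, f x ∂μ = S := by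
  have hF0' : ∀ᵐ x ∂μ, ∀ i, 0 ≤ F i x := ae_all_iff.2 hF0
  have hf0 : 0 ≤ᵐ[μ] f := by
    filter_upwards [hF0', hsum] with x h0 hx using hx.nonneg h0
  have hS0 : 0 ≤ S := hS.nonneg fun i => integral_nonneg_of_ae (hF0 i)
  have key : ∫⁻ x, ENNReal.ofReal (f x) ∂μ = ENNReal.ofReal S := by
    calc
      ∫⁻ x, ENNReal.ofReal (f x) ∂μ = ∫⁻ x, ∑' i, ENNReal.ofReal (F i x) ∂μ := by
        refine lintegral_congr_ae ?_
        filter_upwards [hF0', hsum] with x h0 hx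
        rw [← hx.tsum_eq, ENNReal.ofReal_tsum_of_nonneg h0 hx.summable]
      _ = ∑' i, ∫⁻ x, ENNReal.ofReal (F i x) ∂μ :=
        lintegral_tsum fun i => (hF i).aemeasurable.ennreal_ofReal
      _ = ∑' i, ENNReal.ofReal (∫ x, F i x ∂μ) := by
        simp_rw [← ofReal_integral_eq_lintegral_ofReal (hF _) (hF0 _)]
      _ = ENNReal.ofReal S := by
        rw [← hS.tsum_eq, ENNReal.ofReal_tsum_of_nonneg
          (fun i => integral_nonneg_of_ae (hF0 i)) hS.summable]
  refine ⟨(lintegral_ofReal_ne_top_iff_integrable hf hf0).1 (by simp [key]), ?_⟩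
  rw [integral_eq_lintegral_of_nonneg_ae hf0 hf, key, ENNReal.toReal_ofReal hS0]

/-- `∫₀^∞ t ^ n e^{-ct} dt = n! / c ^ (n + 1)` for `c > 0`. -/
theorem integrableOn_and_integral_pow_mul_exp_neg_mul {c : ℝ} (hc : 0 < c) (n : ℕ) :
    IntegrableOn (fun t : ℝ => t ^ n * Real.exp (-c * t)) (Set.Ioi 0) ∧
      ∫ t in Set.Ioi (0 : ℝ), t ^ n * Real.exp (-c * t) = n.factorial / c ^ (n + 1) := by
  constructor
  · have h := integrableOn_rpow_mul_exp_neg_mul_rpow (s := (n : ℝ)) (p := 1)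
      (by have : (0 : ℝ) ≤ n := n.cast_nonneg
          linarith) one_pos hc
    simpa only [Real.rpow_natCast, Real.rpow_one] using h
  · have h := Real.integral_rpow_mul_exp_neg_mul_Ioi (a := (n : ℝ) + 1) (by positivity) hc
    rw [Real.Gamma_nat_eq_factorial, add_sub_cancel_right, ← Nat.cast_add_one,
      Real.rpow_natCast] at h
    simp only [Real.rpow_natCast, ← neg_mul] at h
    rw [h, one_div, inv_pow]
    field_simp

/-- `∫₀^∞ 2 e^{-ct} (cosh (at) - 1) / t dt = -log (1 - (a/c)²)` for `|a| < c`. -/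
theorem integrableOn_and_integral_exp_mul_cosh_sub_one_div {a c : ℝ} (h : |a| < c) :
    IntegrableOn (fun t : ℝ => 2 * Real.exp (-c * t) * ((Real.cosh (a * t) - 1) / t))
        (Set.Ioi 0) ∧
      ∫ t in Set.Ioi (0 : ℝ), 2 * Real.exp (-c * t) * ((Real.cosh (a * t) - 1) / t) =
        -Real.log (1 - a ^ 2 / c ^ 2) := by
  have hc : 0 < c := (abs_nonneg a).trans_lt h
  let K : ℕ → ℝ := fun m => 2 * a ^ (2 * m + 2) / (2 * m + 2).factorial
  have hK : ∀ m, 0 ≤ K m := fun m => by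
    have : 0 ≤ a ^ (2 * m + 2) := Even.pow_nonneg ⟨m + 1, by ring⟩ a
    positivity
  refine integrable_and_integral_eq_of_hasSum_of_nonneg
    (F := fun (m : ℕ) t => K m * (t ^ (2 * m + 1) * Real.exp (-c * t)))
    (Measurable.aestronglyMeasurable (by fun_prop)) ?_ ?_ ?_ ?_
  · exact fun m => (integrableOn_and_integral_pow_mul_exp_neg_mul hc _).1.const_mul _
  · intro m
    filter_upwards [ae_restrict_mem measurableSet_Ioi] with t ht
    have ht : 0 < t := ht
    have := hK m
    simp only [Pi.zero_apply]
    positivity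
  · filter_upwards [ae_restrict_mem measurableSet_Ioi] with t ht
    have ht : 0 < t := ht
    have h1 := (hasSum_nat_add_iff' 1).2 (Real.hasSum_cosh (a * t))
    simp only [Finset.range_one, Finset.sum_singleton, mul_zero, pow_zero, Nat.factorial_zero,
      Nat.cast_one, div_one] at h1
    have h2 := (h1.div_const t).mul_left (2 * Real.exp (-c * t))
    refine h2.congr_fun fun m => ?_
    simp only [K, mul_add, mul_one, mul_pow]
    field_simp
    ring
  · have hx : |a ^ 2 / c ^ 2| < 1 := by
      rw [abs_of_nonneg (by positivity), div_lt_one (by positivity)]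
      exact sq_lt_sq' (by linarith [(abs_lt.1 h).1]) (abs_lt.1 h).2
    refine (Real.hasSum_pow_div_log_of_abs_lt_one hx).congr_fun fun m => ?_
    rw [integral_const_mul, (integrableOn_and_integral_pow_mul_exp_neg_mul hc _).2]
    simp only [K, Nat.factorial_succ (2 * m + 1), div_pow, ← pow_mul]
    push_cast
    have : ((2 * m + 1).factorial : ℝ) ≠ 0 := by positivity
    field_simp
    ring

/-- Euler's product for the cosine on `(-1, 1)`. -/
theorem tendsto_euler_cos_prod {a : ℝ} (h : |a| < 1) :
    Tendsto (fun n : ℕ => ∏ k ∈ Finset.range n, (1 - a ^ 2 / (2 * (k : ℝ) + 1) ^ 2)) atTop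
      (nhds (Real.cos (Real.pi * a / 2))) := by
  rcases eq_or_ne a 0 with rfl | ha
  · simp
  have hsin : Real.sin (Real.pi * (a / 2)) ≠ 0 := by
    obtain ⟨h1, h2⟩ := abs_lt.1 h
    have hpi := Real.pi_pos
    rw [Ne, Real.sin_eq_zero_iff_of_lt_of_lt (by nlinarith) (by nlinarith)]
    positivity
  have hsplit : ∀ n : ℕ, ∏ j ∈ Finset.range (2 * n), (1 - a ^ 2 / ((j : ℝ) + 1) ^ 2) =
      (∏ k ∈ Finset.range n, (1 - a ^ 2 / (2 * (k : ℝ) + 1) ^ 2)) *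
        ∏ k ∈ Finset.range n, (1 - (a / 2) ^ 2 / ((k : ℝ) + 1) ^ 2) := by
    intro n
    induction n with
    | zero => simp
    | succ n ih =>
      rw [mul_add, mul_one, Finset.prod_range_succ, Finset.prod_range_succ, ih,
        Finset.prod_range_succ, Finset.prod_range_succ]
      have : 1 - a ^ 2 / (((2 * n + 1 : ℕ) : ℝ) + 1) ^ 2 =
          1 - (a / 2) ^ 2 / ((n : ℝ) + 1) ^ 2 := by
        push_cast
        rw [show (2 * (n : ℝ) + 1 + 1) = 2 * (n + 1) by ring, mul_pow, div_pow, div_div]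
      rw [this]
      push_cast
      ring
  have hne : ∀ n : ℕ, ∏ k ∈ Finset.range n, (1 - (a / 2) ^ 2 / ((k : ℝ) + 1) ^ 2) ≠ 0 := by
    intro n
    refine Finset.prod_ne_zero_iff.2 fun k _ => ?_
    have hk : (0 : ℝ) ≤ k := k.cast_nonneg
    have ha2 : a ^ 2 < 1 := (sq_lt_one_iff_abs_lt_one a).2 h
    have : (a / 2) ^ 2 / ((k : ℝ) + 1) ^ 2 < 1 := by
      rw [div_lt_one (by positivity)]
      nlinarith
    linarith
  have h1 := (Real.tendsto_euler_sin_prod a).comp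
    (tendsto_id.const_mul_atTop' (two_pos : (0 : ℕ) < 2))
  have h3 := (h1.div (Real.tendsto_euler_sin_prod (a / 2)) hsin).div_const 2
  rw [show Real.pi * a = 2 * (Real.pi * (a / 2)) by ring, Real.sin_two_mul] at h3
  rw [show Real.pi * a / 2 = Real.pi * (a / 2) by ring]
  have h4 : 2 * Real.sin (Real.pi * (a / 2)) * Real.cos (Real.pi * (a / 2)) /
      Real.sin (Real.pi * (a / 2)) / 2 = Real.cos (Real.pi * (a / 2)) := by
    rw [mul_assoc, mul_div_assoc, mul_div_cancel_left₀ _ hsin, mul_div_cancel_left₀ _ two_ne_zero]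
  rw [h4] at h3
  refine h3.congr fun n => ?_
  have hpi := Real.pi_ne_zero
  have hne' := hne n
  simp only [Function.comp_apply, id_eq, Pi.div_apply, hsplit]
  generalize ∏ k ∈ Finset.range n, (1 - (a / 2) ^ 2 / ((k : ℝ) + 1) ^ 2) = Q at hne' ⊢
  generalize ∏ k ∈ Finset.range n, (1 - a ^ 2 / (2 * (k : ℝ) + 1) ^ 2) = P
  field_simp

theorem hasSum_neg_log_euler_cos {a : ℝ} (h : |a| < 1) :
    HasSum (fun k : ℕ => -Real.log (1 - a ^ 2 / (2 * (k : ℝ) + 1) ^ 2))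
      (-Real.log (Real.cos (Real.pi * a / 2))) := by
  have ha2 : a ^ 2 < 1 := (sq_lt_one_iff_abs_lt_one a).2 h
  have hpos : ∀ k : ℕ, 0 < 1 - a ^ 2 / (2 * (k : ℝ) + 1) ^ 2 := fun k => by
    have hk : (0 : ℝ) ≤ k := k.cast_nonneg
    rw [sub_pos, div_lt_one (by positivity)]
    nlinarith
  have hcos : 0 < Real.cos (Real.pi * a / 2) := by
    obtain ⟨h1, h2⟩ := abs_lt.1 h
    have hpi := Real.pi_pos
    exact Real.cos_pos_of_mem_Ioo ⟨by nlinarith, by nlinarith⟩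
  rw [hasSum_iff_tendsto_nat_of_nonneg]
  · refine ((tendsto_euler_cos_prod h).log hcos.ne').neg.congr fun n => ?_
    rw [Real.log_prod fun k _ => (hpos k).ne', Finset.sum_neg_distrib]
  · intro k
    have : 0 ≤ a ^ 2 / (2 * (k : ℝ) + 1) ^ 2 := by positivity
    exact neg_nonneg.2 (Real.log_nonpos (hpos k).le (by linarith))

/-- Geometric expansion of `1 / sinh t` for `t > 0`. -/
theorem hasSum_inv_sinh {t : ℝ} (ht : 0 < t) :
    HasSum (fun k : ℕ => 2 * Real.exp (-(2 * (k : ℝ) + 1) * t)) (Real.sinh t)⁻¹ := by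
  have hr : Real.exp (-(2 * t)) < 1 := Real.exp_lt_one_iff.2 (by linarith)
  have h := (hasSum_geometric_of_lt_one (Real.exp_nonneg _) hr).mul_left (2 * Real.exp (-t))
  have h1 : 1 - Real.exp (-(2 * t)) = 2 * Real.exp (-t) * Real.sinh t := by
    rw [Real.sinh_eq, show -(2 * t) = -t + -t by ring, Real.exp_add]
    have : Real.exp (-t) * Real.exp t = 1 := by rw [← Real.exp_add]; simp
    linear_combination -this
  rw [h1, mul_inv, mul_inv_cancel_left₀ (by positivity)] at h
  refine h.congr_fun fun k => ?_
  rw [← Real.exp_nat_mul, mul_assoc, ← Real.exp_add]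
  ring_nf

/-- `∫₀^∞ (1 - cosh (at)) / (t sinh t) dt = log (cos (πa/2))` for `|a| < 1`. -/
theorem integrableOn_and_integral_one_sub_cosh_div {a : ℝ} (h : |a| < 1) :
    IntegrableOn (fun t : ℝ => (1 - Real.cosh (t * a)) / (t * Real.sinh t)) (Set.Ioi 0) ∧
      ∫ t in Set.Ioi (0 : ℝ), (1 - Real.cosh (t * a)) / (t * Real.sinh t) =
        Real.log (Real.cos (Real.pi * a / 2)) := by
  have hlt : ∀ k : ℕ, |a| < 2 * (k : ℝ) + 1 := fun k => by
    have hk : (0 : ℝ) ≤ k := k.cast_nonneg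
    linarith
  have hterm := fun k : ℕ => integrableOn_and_integral_exp_mul_cosh_sub_one_div (hlt k)
  have key := integrable_and_integral_eq_of_hasSum_of_nonneg
    (μ := volume.restrict (Set.Ioi (0 : ℝ)))
    (f := fun t => -((1 - Real.cosh (t * a)) / (t * Real.sinh t)))
    (F := fun (k : ℕ) t =>
      2 * Real.exp (-(2 * (k : ℝ) + 1) * t) * ((Real.cosh (a * t) - 1) / t))
    (S := -Real.log (Real.cos (Real.pi * a / 2)))
    (Measurable.aestronglyMeasurable (by fun_prop)) (fun k => (hterm k).1) ?_ ?_ ?_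
  · rw [integral_neg, neg_inj] at key
    exact ⟨integrable_neg_iff.1 key.1, key.2⟩
  · intro k
    filter_upwards [ae_restrict_mem measurableSet_Ioi] with t ht
    have h1 := Real.one_le_cosh (a * t)
    have ht : 0 < t := ht
    exact mul_nonneg (by positivity) (div_nonneg (by linarith) ht.le)
  · filter_upwards [ae_restrict_mem measurableSet_Ioi] with t ht
    convert! (hasSum_inv_sinh ht).mul_right ((Real.cosh (a * t) - 1) / t) using 1
    have hs : Real.sinh t ≠ 0 := (Real.sinh_pos_iff.2 ht).ne'
    have ht : t ≠ 0 := ne_of_gt ht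
    rw [mul_comm a t]
    field_simp
    ring
  · simpa only [fun k => (hterm k).2] using hasSum_neg_log_euler_cos h

theorem exp_mul_sinh_mem_Icc {s t : ℝ} (ht : 0 ≤ t) (hs : 0 ≤ s) (hs1 : s ≤ 1) :
    Real.exp (t * s) * Real.sinh (t * (1 - s)) ∈ Set.Icc 0 (Real.sinh t) := by
  refine ⟨mul_nonneg (Real.exp_nonneg _)
    (Real.sinh_nonneg_iff.2 (mul_nonneg ht (by linarith))), ?_⟩
  have h1 : Real.exp (t * s) * Real.exp (t * (1 - s)) = Real.exp t := by
    rw [← Real.exp_add]; ring_nf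
  have h2 : Real.exp (t * s) * Real.exp (-(t * (1 - s))) = Real.exp (-t + 2 * (t * s)) := by
    rw [← Real.exp_add]; ring_nf
  have h3 : Real.exp (-t) ≤ Real.exp (-t + 2 * (t * s)) :=
    Real.exp_le_exp.2 (by nlinarith [mul_nonneg ht hs])
  rw [Real.sinh_eq, Real.sinh_eq]
  linarith

/-- Large-`N` limit of the exponent `I_N(β)` of the minimal two-particle form
factor of the chiral SU(N) Gross–Neveu model at rapidity `θ = iβ`, `0 < β < 2π`:
each `I_N(β)` is absolutely convergent, `I_N(β) → ∫₀^∞ (1−cosh(t(1−β/π)))/(t sinh t) dt`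
as `N → ∞`, and consequently `exp(I_N(β)) → sin(β/2)`. -/
theorem suN_form_factor_large_N (β : ℝ) (hβ0 : 0 < β) (hβ2 : β < 2 * Real.pi) :
    (∀ N : ℕ, 2 ≤ N →
      IntegrableOn (fun t : ℝ =>
          Real.exp (t / N) * Real.sinh (t * (1 - 1 / N)) *
            (1 - Real.cosh (t * (1 - β / Real.pi))) / (t * Real.sinh t ^ 2))
        (Set.Ioi 0)) ∧
    Tendsto (fun N : ℕ =>
        ∫ t in Set.Ioi (0 : ℝ),
          Real.exp (t / N) * Real.sinh (t * (1 - 1 / N)) *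
            (1 - Real.cosh (t * (1 - β / Real.pi))) / (t * Real.sinh t ^ 2))
      atTop
      (nhds (∫ t in Set.Ioi (0 : ℝ),
        (1 - Real.cosh (t * (1 - β / Real.pi))) / (t * Real.sinh t))) ∧
    Tendsto (fun N : ℕ =>
        Real.exp (∫ t in Set.Ioi (0 : ℝ),
          Real.exp (t / N) * Real.sinh (t * (1 - 1 / N)) *
            (1 - Real.cosh (t * (1 - β / Real.pi))) / (t * Real.sinh t ^ 2)))
      atTop (nhds (Real.sin (β / 2))) := by
  set a : ℝ := 1 - β / Real.pi with ha_def
  have hpi := Real.pi_pos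
  have ha : |a| < 1 := by
    have h1 : 0 < β / Real.pi := by positivity
    have h2 : β / Real.pi < 2 := by rwa [div_lt_iff₀ hpi]
    rw [abs_lt]
    constructor <;> linarith
  obtain ⟨hint, hval⟩ := integrableOn_and_integral_one_sub_cosh_div ha
  have hcos : Real.cos (Real.pi * a / 2) = Real.sin (β / 2) := by
    rw [← Real.cos_pi_div_two_sub, ha_def]
    congr 1
    field_simp
  have hmeas : ∀ N : ℕ, AEStronglyMeasurable (fun t : ℝ =>
      Real.exp (t / N) * Real.sinh (t * (1 - 1 / N)) *
        (1 - Real.cosh (t * a)) / (t * Real.sinh t ^ 2)) (volume.restrict (Set.Ioi 0)) :=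
    fun N => Measurable.aestronglyMeasurable (by fun_prop)
  have hfactor : ∀ (N : ℕ) (t : ℝ), 0 < t →
      Real.exp (t / N) * Real.sinh (t * (1 - 1 / N)) *
        (1 - Real.cosh (t * a)) / (t * Real.sinh t ^ 2) =
      Real.exp (t * (1 / N)) * Real.sinh (t * (1 - 1 / N)) / Real.sinh t *
        ((1 - Real.cosh (t * a)) / (t * Real.sinh t)) := fun N t ht => by
    have hs : Real.sinh t ≠ 0 := (Real.sinh_pos_iff.2 ht).ne'
    rw [mul_one_div]
    field_simp
  have hbound : ∀ N : ℕ, 2 ≤ N → ∀ᵐ t ∂(volume.restrict (Set.Ioi (0 : ℝ))),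
      ‖Real.exp (t / N) * Real.sinh (t * (1 - 1 / N)) *
        (1 - Real.cosh (t * a)) / (t * Real.sinh t ^ 2)‖ ≤
      ‖(1 - Real.cosh (t * a)) / (t * Real.sinh t)‖ := fun N hN => by
    filter_upwards [ae_restrict_mem measurableSet_Ioi] with t ht
    have hN1 : (1 : ℝ) ≤ N := by exact_mod_cast (by omega : 1 ≤ N)
    obtain ⟨h0, h1⟩ := exp_mul_sinh_mem_Icc (s := 1 / (N : ℝ)) (le_of_lt ht) (by positivity)
      ((div_le_one (by positivity)).2 hN1)
    have hs : 0 < Real.sinh t := Real.sinh_pos_iff.2 ht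
    rw [hfactor N t ht, norm_mul, Real.norm_of_nonneg (div_nonneg h0 hs.le)]
    exact mul_le_of_le_one_left (norm_nonneg _) ((div_le_one hs).2 h1)
  have hlim : Tendsto (fun N : ℕ => ∫ t in Set.Ioi (0 : ℝ),
      Real.exp (t / N) * Real.sinh (t * (1 - 1 / N)) *
        (1 - Real.cosh (t * a)) / (t * Real.sinh t ^ 2)) atTop
      (nhds (∫ t in Set.Ioi (0 : ℝ), (1 - Real.cosh (t * a)) / (t * Real.sinh t))) := by
    refine tendsto_integral_filter_of_dominated_convergence _ (Eventually.of_forall hmeas)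
      ((eventually_ge_atTop 2).mono hbound) hint.norm ?_
    filter_upwards [ae_restrict_mem measurableSet_Ioi] with t ht
    have hs : Real.sinh t ≠ 0 := (Real.sinh_pos_iff.2 ht).ne'
    have hcont : Continuous fun s : ℝ => Real.exp (t * s) * Real.sinh (t * (1 - s)) /
        Real.sinh t * ((1 - Real.cosh (t * a)) / (t * Real.sinh t)) := by fun_prop
    have h := (hcont.tendsto 0).comp tendsto_one_div_atTop_nhds_zero_nat
    simp only [mul_zero, Real.exp_zero, sub_zero, mul_one, one_mul, div_self hs] at h
    exact h.congr fun N => (hfactor N t ht).symm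
  refine ⟨fun N hN => hint.norm.mono' (hmeas N) (hbound N hN), hlim, ?_⟩
  have hsin : 0 < Real.sin (β / 2) := Real.sin_pos_of_pos_of_lt_pi (by linarith) (by linarith)
  rw [hval, hcos] at hlim
  simpa only [Function.comp_def, Real.exp_log hsin] using
    (Real.continuous_exp.tendsto _).comp hlim
end

section
/- For every real β with 0 < β < 2π and every integer N ≥ 3, the integral J_N(β) = ∫₀^∞ e^{t/N}·sinh(t/N)·(1 − cosh(t(1 − β/π))) / (t·sinh² t) dt is absolutely convergent, and J_N(β) → 0 as N → ∞; consequently exp(J_N(β)) → 1 as N → ∞. -/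
open MeasureTheory Filter

lemma exp_mul_sinh_le (x : ℝ) : Real.exp x * Real.sinh x ≤ x * Real.exp (2 * x) := by
  have h := Real.add_one_le_exp (-(2 * x))
  have h1 : Real.exp (2 * x) * Real.exp (-(2 * x)) = 1 := by rw [← Real.exp_add]; simp
  have h2 : Real.exp x * Real.sinh x = (Real.exp (2 * x) - 1) / 2 := by
    rw [Real.sinh_eq, two_mul, Real.exp_add]
    have h3 : Real.exp x * Real.exp (-x) = 1 := by rw [← Real.exp_add]; simp
    linear_combination -h3 / 2
  rw [h2]
  nlinarith [Real.exp_pos (2 * x)]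

lemma cosh_mul_sub_one_div_sinh_sq_le {a t : ℝ} (ha : |a| ≤ 1) (ht : 0 < t) :
    (Real.cosh (t * a) - 1) / Real.sinh t ^ 2 ≤ 2 * Real.exp (-t) := by
  have hs : 0 < Real.sinh t := Real.sinh_pos_iff.2 ht
  have hc : Real.cosh (t * a) ≤ Real.cosh t := by
    rw [Real.cosh_le_cosh, abs_mul]
    exact mul_le_of_le_one_right (abs_nonneg t) ha
  have h1 : 1 ≤ Real.cosh t := Real.one_le_cosh t
  have h2 : Real.exp t ≤ 2 * (Real.cosh t + 1) := by
    rw [Real.cosh_eq]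
    linarith [Real.exp_pos (-t)]
  have h3 : Real.exp (-t) * Real.exp t = 1 := by rw [← Real.exp_add]; simp
  have h4 : 1 ≤ 2 * Real.exp (-t) * (Real.cosh t + 1) := by
    nlinarith [Real.exp_pos (-t)]
  rw [div_le_iff₀ (by positivity), Real.sinh_sq]
  nlinarith

/-- The integrand of the exponent is dominated by `(2 / N) * exp (-t / 3)`. -/
lemma norm_form_factor_integrand_le {a t : ℝ} (ha : |a| ≤ 1) (ht : 0 < t) {N : ℕ} (hN : 3 ≤ N) :
    ‖Real.exp (t / N) * Real.sinh (t / N) * (1 - Real.cosh (t * a)) / (t * Real.sinh t ^ 2)‖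
      ≤ 2 / N * Real.exp (-(1 / 3) * t) := by
  have hN' : (3 : ℝ) ≤ N := by exact_mod_cast hN
  have hN0 : (0 : ℝ) < N := by linarith
  have hx : 0 < t / N := by positivity
  have hs : 0 < Real.sinh t := Real.sinh_pos_iff.2 ht
  have hsx : 0 < Real.sinh (t / N) := Real.sinh_pos_iff.2 hx
  have hc : 0 ≤ Real.cosh (t * a) - 1 := by linarith [Real.one_le_cosh (t * a)]
  have hle : t / N ≤ t / 3 := by gcongr
  have hexp : Real.exp (t / N) * Real.sinh (t / N) ≤ t / N * Real.exp (2 * (t / 3)) :=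
    (exp_mul_sinh_le _).trans (by gcongr)
  calc _ = Real.exp (t / N) * Real.sinh (t / N) / t *
        ((Real.cosh (t * a) - 1) / Real.sinh t ^ 2) := by
        rw [← norm_neg, Real.norm_of_nonneg]
        · field_simp
          ring
        · rw [← neg_div, ← mul_neg, neg_sub]
          positivity
    _ ≤ (t / N * Real.exp (2 * (t / 3))) / t * (2 * Real.exp (-t)) := by
        gcongr
        exact cosh_mul_sub_one_div_sinh_sq_le ha ht
    _ = 2 / N * (Real.exp (2 * (t / 3)) * Real.exp (-t)) := by
        field_simp
    _ = _ := by
        rw [← Real.exp_add]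
        ring_nf

/-- Large-`N` limit of the exponent `J_N(β)` of the minimal form factor `G` for
one rank-1 and one rank-(N−1) particle of the chiral SU(N) Gross–Neveu model at
rapidity `θ = iβ`, `0 < β < 2π`: for `N ≥ 3` each `J_N(β)` is absolutely
convergent, `J_N(β) → 0` as `N → ∞`, and consequently `exp(J_N(β)) → 1`. -/
theorem suN_form_factor_G_large_N (β : ℝ) (hβ0 : 0 < β) (hβ2 : β < 2 * Real.pi) :
    (∀ N : ℕ, 3 ≤ N →
      IntegrableOn (fun t : ℝ =>
          Real.exp (t / N) * Real.sinh (t / N) *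
            (1 - Real.cosh (t * (1 - β / Real.pi))) / (t * Real.sinh t ^ 2))
        (Set.Ioi 0)) ∧
    Tendsto (fun N : ℕ =>
        ∫ t in Set.Ioi (0 : ℝ),
          Real.exp (t / N) * Real.sinh (t / N) *
            (1 - Real.cosh (t * (1 - β / Real.pi))) / (t * Real.sinh t ^ 2))
      atTop (nhds 0) ∧
    Tendsto (fun N : ℕ =>
        Real.exp (∫ t in Set.Ioi (0 : ℝ),
          Real.exp (t / N) * Real.sinh (t / N) *
            (1 - Real.cosh (t * (1 - β / Real.pi))) / (t * Real.sinh t ^ 2)))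
      atTop (nhds 1) := by
  have ha : |1 - β / Real.pi| ≤ 1 := by
    have h0 : 0 < β / Real.pi := div_pos hβ0 Real.pi_pos
    have h2 : β / Real.pi < 2 := (div_lt_iff₀ Real.pi_pos).2 hβ2
    exact abs_le.2 ⟨by linarith, by linarith⟩
  have hint : IntegrableOn (fun t : ℝ => Real.exp (-(1 / 3) * t)) (Set.Ioi 0) :=
    integrableOn_exp_mul_Ioi (by norm_num) 0
  have hbound : ∀ N : ℕ, 3 ≤ N → ∀ᵐ t ∂volume.restrict (Set.Ioi (0 : ℝ)),
      ‖Real.exp (t / N) * Real.sinh (t / N) * (1 - Real.cosh (t * (1 - β / Real.pi))) /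
        (t * Real.sinh t ^ 2)‖ ≤ 2 / N * Real.exp (-(1 / 3) * t) := fun N hN =>
    (ae_restrict_mem measurableSet_Ioi).mono fun t ht => norm_form_factor_integrand_le ha ht hN
  have hlim : Tendsto (fun N : ℕ =>
      ∫ t in Set.Ioi (0 : ℝ), Real.exp (t / N) * Real.sinh (t / N) *
        (1 - Real.cosh (t * (1 - β / Real.pi))) / (t * Real.sinh t ^ 2)) atTop (nhds 0) := by
    refine squeeze_zero_norm' (a := fun N : ℕ =>
      2 / (N : ℝ) * ∫ t in Set.Ioi (0 : ℝ), Real.exp (-(1 / 3) * t)) ?_ ?_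
    · filter_upwards [eventually_ge_atTop 3] with N hN
      rw [← integral_const_mul]
      exact norm_integral_le_of_norm_le (hint.const_mul _) (hbound N hN)
    · simpa using (tendsto_const_div_atTop_nhds_zero_nat (2 : ℝ)).mul_const
        (∫ t in Set.Ioi (0 : ℝ), Real.exp (-(1 / 3) * t))
  refine ⟨fun N hN => ?_, hlim, ?_⟩
  · refine (hint.const_mul (2 / (N : ℝ))).mono' ?_ (hbound N hN)
    exact Measurable.aestronglyMeasurable (by fun_prop)
  · simpa only [Real.exp_zero] using hlim.rexp
end

section
/- For every real x with 0 < |x| < 2, the integral ∫₀^∞ (1 − cosh(x·t)) / sinh² t dt is absolutely convergent and equals (πx/2)·cot(πx/2) − 1. -/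
open MeasureTheory

lemma hasSum_mul_exp_neg_two_mul {t : ℝ} (ht : 0 < t) :
    HasSum (fun n : ℕ => 4 * ((n : ℝ) + 1) * Real.exp (-(2 * ((n : ℝ) + 1)) * t))
      (1 / Real.sinh t ^ 2) := by
  have hr1 : Real.exp (-2 * t) < 1 := by
    rw [Real.exp_lt_one_iff]
    linarith
  have hr : ‖Real.exp (-2 * t)‖ < 1 := by rwa [Real.norm_of_nonneg (Real.exp_nonneg _)]
  have h0 : HasSum (fun n : ℕ => (n : ℝ) * Real.exp (-2 * t) ^ n)
      (Real.exp (-2 * t) / (1 - Real.exp (-2 * t)) ^ 2) :=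
    hasSum_coe_mul_geometric_of_norm_lt_one hr
  have h := (hasSum_nat_add_iff' (f := fun n : ℕ => (n : ℝ) * Real.exp (-2 * t) ^ n) 1).2 h0
  have hval : 4 * (Real.exp (-2 * t) / (1 - Real.exp (-2 * t)) ^ 2) = 1 / Real.sinh t ^ 2 := by
    have hsq : Real.exp (-2 * t) = Real.exp (-t) ^ 2 := by
      rw [← Real.exp_nat_mul]
      push_cast
      ring_nf
    have he := Real.exp_pos t
    have he1 : 1 < Real.exp t := Real.one_lt_exp_iff.2 ht
    have hne : Real.exp t ^ 2 - 1 ≠ 0 := by nlinarith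
    rw [hsq, Real.sinh_eq, Real.exp_neg]
    generalize Real.exp t = y at he he1 hne ⊢
    have h1 : (y - y⁻¹) / 2 = (y ^ 2 - 1) / (2 * y) := by field_simp
    have h2 : 1 - y⁻¹ ^ 2 = (y ^ 2 - 1) / y ^ 2 := by field_simp
    rw [h1, h2]
    field_simp
    norm_num
  simp only [Finset.range_one, Finset.sum_singleton, Nat.cast_zero, zero_mul, sub_zero] at h
  rw [← hval]
  convert! h.mul_left 4 using 2 with n
  rw [← Real.exp_nat_mul]
  push_cast
  ring_nf

lemma exp_mul_one_sub_cosh (a x t : ℝ) :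
    2 * a * Real.exp (-a * t) * (1 - Real.cosh (x * t)) =
      2 * a * Real.exp (-a * t) - a * Real.exp ((x - a) * t) - a * Real.exp ((-x - a) * t) := by
  have h1 : (x - a) * t = -a * t + x * t := by ring
  have h2 : (-x - a) * t = -a * t + -(x * t) := by ring
  rw [Real.cosh_eq, h1, h2, Real.exp_add, Real.exp_add]
  ring

lemma integrableOn_exp_mul_one_sub_cosh {a x : ℝ} (h : |x| < a) :
    IntegrableOn (fun t : ℝ => 2 * a * Real.exp (-a * t) * (1 - Real.cosh (x * t)))
      (Set.Ioi 0) := by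
  obtain ⟨h1, h2⟩ := abs_lt.1 h
  simp only [exp_mul_one_sub_cosh]
  exact (((integrableOn_exp_mul_Ioi (by linarith) 0).const_mul _).sub
    ((integrableOn_exp_mul_Ioi (by linarith) 0).const_mul _)).sub
    ((integrableOn_exp_mul_Ioi (by linarith) 0).const_mul _)

lemma integral_exp_mul_one_sub_cosh {a x : ℝ} (h : |x| < a) :
    ∫ t in Set.Ioi (0 : ℝ), 2 * a * Real.exp (-a * t) * (1 - Real.cosh (x * t)) =
      -(2 * x ^ 2 / (a ^ 2 - x ^ 2)) := by
  obtain ⟨h1, h2⟩ := abs_lt.1 h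
  have i0 := (integrableOn_exp_mul_Ioi (a := -a) (by linarith) 0).const_mul (2 * a)
  have i1 := (integrableOn_exp_mul_Ioi (a := x - a) (by linarith) 0).const_mul a
  have i2 := (integrableOn_exp_mul_Ioi (a := -x - a) (by linarith) 0).const_mul a
  simp only [exp_mul_one_sub_cosh]
  have i01 : IntegrableOn (fun t => 2 * a * Real.exp (-a * t) - a * Real.exp ((x - a) * t))
      (Set.Ioi 0) := i0.sub i1
  rw [integral_sub i01 i2, integral_sub i0 i1]
  simp only [integral_const_mul]
  rw [integral_exp_mul_Ioi (by linarith), integral_exp_mul_Ioi (by linarith),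
    integral_exp_mul_Ioi (by linarith)]
  simp only [mul_zero, Real.exp_zero]
  have n0 : a ≠ 0 := by linarith
  have n1 : x - a ≠ 0 := by linarith
  have n2 : -x - a ≠ 0 := by linarith
  have n3 : a ^ 2 - x ^ 2 ≠ 0 := by
    have : a ^ 2 - x ^ 2 = (x - a) * (-x - a) := by ring
    rw [this]
    exact mul_ne_zero n1 n2
  field_simp
  ring

lemma half_mem_integerComplement {x : ℝ} (hx0 : 0 < |x|) (hx2 : |x| < 2) :
    ((x / 2 : ℝ) : ℂ) ∈ Complex.integerComplement := by
  rw [Complex.mem_integerComplement_iff]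
  rintro ⟨n, hn⟩
  have hn' : (n : ℝ) = x / 2 := by exact_mod_cast hn
  have hx : x = 2 * n := by linarith
  have hlt : |(n : ℝ)| < 1 := by
    rw [hn', abs_div, abs_two]
    linarith
  have hn0 : n = 0 := Int.abs_lt_one_iff.1 (by exact_mod_cast hlt)
  simp [hx, hn0] at hx0

lemma hasSum_cot_half {x : ℝ} (hx0 : 0 < |x|) (hx2 : |x| < 2) :
    HasSum (fun n : ℕ => -(2 * x ^ 2 / ((2 * ((n : ℝ) + 1)) ^ 2 - x ^ 2)))
      ((Real.pi * x / 2) * (Real.cos (Real.pi * x / 2) / Real.sin (Real.pi * x / 2)) - 1) := by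
  have hz := half_mem_integerComplement hx0 hx2
  have hx : x ≠ 0 := abs_pos.1 hx0
  have h := ((summable_cotTerm hz).hasSum).mul_left ((x / 2 : ℝ) : ℂ)
  simp only [cotTerm] at h
  rw [← cot_series_rep' hz] at h
  rw [← Complex.hasSum_ofReal]
  obtain ⟨h1, h2⟩ := abs_lt.1 hx2
  convert! h using 1
  · funext n
    norm_cast
    have hn : (0 : ℝ) ≤ n := n.cast_nonneg
    push_cast
    have n1 : x / 2 - (n + 1) ≠ 0 := by linarith
    have n2 : x / 2 + (n + 1) ≠ 0 := by linarith
    have n3 : (2 * ((n : ℝ) + 1)) ^ 2 - x ^ 2 = -4 * ((x / 2 - (n + 1)) * (x / 2 + (n + 1))) := by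
      ring
    rw [n3, one_div_add_one_div n1 n2]
    field_simp
    ring
  · rw [Complex.cot_eq_cos_div_sin]
    have hpi : Real.pi * x / 2 = Real.pi * (x / 2) := by ring
    rw [hpi]
    have hxc : (x : ℂ) ≠ 0 := by exact_mod_cast hx
    push_cast
    field_simp

/-- For `0 < |x| < 2`, `∫₀^∞ (1 − cosh(x·t))/sinh²t dt = (πx/2)·cot(πx/2) − 1`,
the integral being absolutely convergent. -/
theorem integral_one_sub_cosh_div_sinh_sq (x : ℝ) (hx0 : 0 < |x|) (hx2 : |x| < 2) :
    IntegrableOn (fun t : ℝ => (1 - Real.cosh (x * t)) / Real.sinh t ^ 2)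
      (Set.Ioi 0) ∧
    (∫ t in Set.Ioi (0 : ℝ), (1 - Real.cosh (x * t)) / Real.sinh t ^ 2) =
      (Real.pi * x / 2) * (Real.cos (Real.pi * x / 2) / Real.sin (Real.pi * x / 2)) - 1 := by
  set F : ℕ → ℝ → ℝ := fun n t =>
    2 * (2 * ((n : ℝ) + 1)) * Real.exp (-(2 * ((n : ℝ) + 1)) * t) * (1 - Real.cosh (x * t))
    with hF
  have hlt (n : ℕ) : |x| < 2 * ((n : ℝ) + 1) := by
    have hn : (0 : ℝ) ≤ n := n.cast_nonneg
    linarith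
  have hint (n : ℕ) : IntegrableOn (F n) (Set.Ioi 0) := integrableOn_exp_mul_one_sub_cosh (hlt n)
  have hval (n : ℕ) : ∫ t in Set.Ioi (0 : ℝ), F n t =
      -(2 * x ^ 2 / ((2 * ((n : ℝ) + 1)) ^ 2 - x ^ 2)) := integral_exp_mul_one_sub_cosh (hlt n)
  have hnorm (n : ℕ) (t : ℝ) : ‖F n t‖ = -F n t :=
    Real.norm_of_nonpos (mul_nonpos_of_nonneg_of_nonpos (by positivity)
      (sub_nonpos.2 (Real.one_le_cosh _)))
  have hcot := hasSum_cot_half hx0 hx2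
  have hsum : Summable fun n => ∫ t in Set.Ioi (0 : ℝ), ‖F n t‖ := by
    simp only [hnorm, integral_neg, hval]
    exact hcot.summable.neg
  have hseries := hasSum_integral_of_summable_integral_norm hint hsum
  have hcongr : ∫ t in Set.Ioi (0 : ℝ), ∑' n, F n t =
      ∫ t in Set.Ioi (0 : ℝ), (1 - Real.cosh (x * t)) / Real.sinh t ^ 2 := by
    refine setIntegral_congr_fun measurableSet_Ioi fun t ht => ?_
    refine HasSum.tsum_eq ?_
    convert! (hasSum_mul_exp_neg_two_mul ht).mul_right (1 - Real.cosh (x * t)) using 1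
    · funext n
      simp only [hF]
      ring
    · ring
  simp only [hval, hcongr] at hseries
  have heq := hseries.unique hcot
  refine ⟨not_imp_comm.1 integral_undef ?_, heq⟩
  have hpos (n : ℕ) : 0 < 2 * x ^ 2 / ((2 * ((n : ℝ) + 1)) ^ 2 - x ^ 2) := by
    have hsq : x ^ 2 < (2 * ((n : ℝ) + 1)) ^ 2 := sq_lt_sq' (abs_lt.1 (hlt n)).1 (abs_lt.1 (hlt n)).2
    have hx : x ≠ 0 := abs_pos.1 hx0
    exact div_pos (by positivity) (sub_pos.2 hsq)
  have hneg := hseries.neg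
  simp only [neg_neg] at hneg
  have := hneg.summable.tsum_pos (fun n => (hpos n).le) 0 (hpos 0)
  rw [hneg.tsum_eq] at this
  exact (neg_pos.1 this).ne
end
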